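/- arXiv:math/0110079 — 12 statements merged into one kernel-verified Lean document; each statement's English description precedes it below -/
import Mathlib

section
/- Let Δ be a finite pure d-dimensional simplicial complex equipped with projection maps satisfying axioms (P1), (P2) and (P3). For each chamber C define R_C : C → faces of Δ by R_C(D) = {v ∈ D : (D ∖ {v})C ≠ D}. Then the maps R_C satisfy the restriction axioms (R1), (R2) and (R3). (Implication (P) ⟹ (R) of the main theorem.) -/
open scoped Classical

/-- A finite abstract simplicial complex on a vertex type `V`:
a finite family of finite subsets (faces) containing the empty face and
closed under taking subsets. -/
structure Cplx (V : Type*) [DecidableEq V] where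
  faces : Finset (Finset V)
  empty_mem : ∅ ∈ faces
  down_closed : ∀ F ∈ faces, ∀ G, G ⊆ F → G ∈ faces

namespace Cplx

variable {V : Type*} [DecidableEq V]

/-- A chamber is a maximal face. -/
def Chamber (Δ : Cplx V) (D : Finset V) : Prop :=
  D ∈ Δ.faces ∧ ∀ E ∈ Δ.faces, D ⊆ E → E = D

/-- `Δ` is pure of rank `n` (dimension `n-1`): every chamber has `n` vertices. -/
def Pure (Δ : Cplx V) (n : ℕ) : Prop :=
  ∀ D, Δ.Chamber D → D.card = n

/-- `G` is a facet (codimension-one face) of the chamber `D`. -/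
def IsFacetOf (Δ : Cplx V) (G D : Finset V) : Prop :=
  G ⊆ D ∧ G.card + 1 = D.card

/-- `D` and `E` are weakly `C`-adjacent: they are chambers with a common face `F`
such that `FC = D`. -/
def WeakAdj (Δ : Cplx V) (proj : Finset V → Finset V → Finset V)
    (C D E : Finset V) : Prop :=
  Δ.Chamber D ∧ Δ.Chamber E ∧ ∃ F ∈ Δ.faces, F ⊆ D ∧ F ⊆ E ∧ proj F C = D

end Cplx

/-- The projection axioms (P1), (P2), (P3) for projection maps `(F, C) ↦ FC`. -/
structure ProjAxioms {V : Type*} [DecidableEq V] (Δ : Cplx V)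
    (proj : Finset V → Finset V → Finset V) : Prop where
  chamber : ∀ F ∈ Δ.faces, ∀ C, Δ.Chamber C → Δ.Chamber (proj F C)
  p1i : ∀ F ∈ Δ.faces, ∀ C, Δ.Chamber C → F ⊆ proj F C
  p1ii : ∀ F ∈ Δ.faces, ∀ C, Δ.Chamber C → F ⊆ C → proj F C = C
  p1iii : ∀ F ∈ Δ.faces, ∀ C G, Δ.Chamber C → F ⊆ G → G ⊆ proj F C →
    proj G C = proj F C
  p2 : ∀ F ∈ Δ.faces, ∀ C D, Δ.Chamber C → Δ.Chamber D → F ⊆ D →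
    (∀ G, F ⊆ G → Δ.IsFacetOf G D → proj G C = D) → proj F C = D
  p3 : ∀ F ∈ Δ.faces, ∀ C C₁ D, Δ.Chamber C → Δ.Chamber C₁ → proj F C = D →
    Relation.ReflTransGen (Δ.WeakAdj proj C) C₁ D → proj F C₁ = D

/-- The restriction map associated to projection maps:
`R_C(D) = {v ∈ D : (D ∖ {v})C ≠ D}`. -/
def resOf {V : Type*} [DecidableEq V] (proj : Finset V → Finset V → Finset V)
    (C D : Finset V) : Finset V :=
  D.filter fun v => proj (D.erase v) C ≠ D

/-- The restriction axioms (R1), (R2), (R3) for restriction maps `R_C`. -/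
structure ResAxioms {V : Type*} [DecidableEq V] (Δ : Cplx V)
    (R : Finset V → Finset V → Finset V) : Prop where
  r1a : ∀ C, Δ.Chamber C → R C C = ∅
  r1b : ∀ C D, Δ.Chamber C → Δ.Chamber D → R C D ⊆ D
  r2 : ∀ C, Δ.Chamber C → ∀ F ∈ Δ.faces, ∃! D, Δ.Chamber D ∧ R C D ⊆ F ∧ F ⊆ D
  r3 : ∀ C C₁ Cₙ, Δ.Chamber C → Δ.Chamber C₁ →
    Relation.ReflTransGen (fun E D => Δ.Chamber E ∧ Δ.Chamber D ∧ R C E ⊆ D) C₁ Cₙ →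
    R C₁ Cₙ ⊆ R C Cₙ

theorem mem_resOf {V : Type*} [DecidableEq V] {proj : Finset V → Finset V → Finset V}
    {C D : Finset V} {v : V} : v ∈ resOf proj C D ↔ v ∈ D ∧ proj (D.erase v) C ≠ D := by
  simp [resOf]

/-- For a face `F` of the chamber `D`, we have `FC = D` exactly when `R_C(D) ⊆ F`. -/
theorem ProjAxioms.proj_eq_iff {V : Type*} [DecidableEq V] {Δ : Cplx V}
    {proj : Finset V → Finset V → Finset V} (hP : ProjAxioms Δ proj) {C D F : Finset V}
    (hC : Δ.Chamber C) (hD : Δ.Chamber D) (hF : F ⊆ D) :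
    proj F C = D ↔ resOf proj C D ⊆ F := by
  have hFΔ := Δ.down_closed D hD.1 F hF
  constructor
  · intro h v hv
    obtain ⟨-, hv⟩ := mem_resOf.1 hv
    by_contra hvF
    refine hv ((hP.p1iii F hFΔ C (D.erase v) hC ?_ ?_).trans h)
    · exact Finset.subset_erase.2 ⟨hF, hvF⟩
    · rw [h]
      exact Finset.erase_subset v D
  · intro h
    refine hP.p2 F hFΔ C D hC hD hF fun G hFG hG => ?_
    obtain ⟨v, hvG, rfl⟩ := Finset.exists_eq_insert_iff.2 hG
    by_contra hne
    exact hvG (hFG (h (mem_resOf.2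
      ⟨Finset.mem_insert_self v G, by rwa [Finset.erase_insert hvG]⟩)))

/-- (P) ⟹ (R): the restriction maps defined from projection maps satisfying the
projection axioms satisfy the restriction axioms. -/
theorem stmt_0 {V : Type*} [DecidableEq V] (Δ : Cplx V) (d : ℕ)
    (hpure : Δ.Pure (d + 1))
    (proj : Finset V → Finset V → Finset V) (hP : ProjAxioms Δ proj) :
    ResAxioms Δ (resOf proj) := by
  have hsub : ∀ C D, resOf proj C D ⊆ D := fun C D => Finset.filter_subset _ _
  refine ⟨fun C hC => ?_, fun C D _ _ => hsub C D, fun C hC F hF => ?_,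
    fun C C₁ Cₙ hC hC₁ h => ?_⟩
  · exact Finset.subset_empty.1 ((hP.proj_eq_iff hC hC (Finset.empty_subset C)).1
      (hP.p1ii ∅ Δ.empty_mem C hC (Finset.empty_subset C)))
  · have hch := hP.chamber F hF C hC
    have hle := hP.p1i F hF C hC
    refine ⟨proj F C, ⟨hch, (hP.proj_eq_iff hC hch hle).1 rfl, hle⟩, ?_⟩
    rintro D ⟨hD, hR, hFD⟩
    exact ((hP.proj_eq_iff hC hD hFD).2 hR).symm
  · have hface : ∀ D, Δ.Chamber D → resOf proj C D ∈ Δ.faces := fun D hD =>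
      Δ.down_closed D hD.1 _ (hsub C D)
    have hproj : ∀ D, Δ.Chamber D → proj (resOf proj C D) C = D := fun D hD =>
      (hP.proj_eq_iff hC hD (hsub C D)).2 Finset.Subset.rfl
    have hCₙ : Δ.Chamber Cₙ := by
      rcases h.cases_tail with rfl | ⟨_, _, h'⟩
      · exact hC₁
      · exact h'.2.1
    have hgal : Relation.ReflTransGen (Δ.WeakAdj proj C) C₁ Cₙ :=
      Relation.ReflTransGen.mono (fun E D ⟨hE, hD, hED⟩ =>
        ⟨hE, hD, resOf proj C E, hface E hE, hsub C E, hED, hproj E hE⟩) _ _ h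
    exact (hP.proj_eq_iff hC₁ hCₙ (hsub C Cₙ)).1
      (hP.p3 _ (hface Cₙ hCₙ) C C₁ Cₙ hC hC₁ (hproj Cₙ hCₙ) hgal)
end

section
/- Let Δ be a finite pure d-dimensional simplicial complex equipped with maps R_C (one for each chamber C) satisfying the restriction axioms (R1), (R2) and (R3). For each chamber C let ≤_C be the transitive closure of the relation on chambers given by E ⪯ D iff R_C(E) ≤ D. Then each ≤_C is a partial order on the set of chambers, and these partial orders satisfy the shelling axioms (S1), (S2) and (S3). (Implication (R) ⟹ (S) of the main theorem.) -/
open scoped Classical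

/-- `r` is a linear order on the set of chambers of `Δ`. -/
def LinOrderOn {V : Type*} [DecidableEq V] (Δ : Cplx V)
    (r : Finset V → Finset V → Prop) : Prop :=
  (∀ D, Δ.Chamber D → r D D) ∧
  (∀ D E, Δ.Chamber D → Δ.Chamber E → r D E → r E D → D = E) ∧
  (∀ D E F, Δ.Chamber D → Δ.Chamber E → Δ.Chamber F → r D E → r E F → r D F) ∧
  (∀ D E, Δ.Chamber D → Δ.Chamber E → r D E ∨ r E D)

/-- `F` is a face of `D` contained in some chamber strictly earlier than `D`
in the order `r`. -/
def EarlierFace {V : Type*} [DecidableEq V] (Δ : Cplx V)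
    (r : Finset V → Finset V → Prop) (D F : Finset V) : Prop :=
  ∃ E, Δ.Chamber E ∧ E ≠ D ∧ r E D ∧ F ⊆ E

/-- `r` is a shelling of `Δ`: a linear order on chambers so that for every chamber
`D` other than the first one, the intersection of `D` with the union of the earlier
chambers is a nonempty union of facets of `D`. -/
def IsShelling {V : Type*} [DecidableEq V] (Δ : Cplx V)
    (r : Finset V → Finset V → Prop) : Prop :=
  LinOrderOn Δ r ∧
  ∀ D, Δ.Chamber D → (∃ E, Δ.Chamber E ∧ E ≠ D ∧ r E D) →
    (∃ F, F ⊆ D ∧ EarlierFace Δ r D F) ∧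
    (∀ F, F ⊆ D → (EarlierFace Δ r D F ↔
      ∃ G, Δ.IsFacetOf G D ∧ F ⊆ G ∧ EarlierFace Δ r D G))

/-- For a chamber `C`, the relation `≤_C` on chambers: the transitive closure of
`E ⪯ D` iff `R_C(E) ≤ D`. -/
def leOfRes {V : Type*} [DecidableEq V] (Δ : Cplx V)
    (R : Finset V → Finset V → Finset V) (C : Finset V) :
    Finset V → Finset V → Prop :=
  Relation.TransGen (fun E D => Δ.Chamber E ∧ Δ.Chamber D ∧ R C E ⊆ D)

namespace ResAxioms

variable {V : Type*} [DecidableEq V] {Δ : Cplx V} {R : Finset V → Finset V → Finset V}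

/-- If `D ≤_C E` and `R_C(E) ⊆ D`, then `D = E`. -/
theorem eq_of_le_of_subset (hR : ResAxioms Δ R) {C D E : Finset V} (hC : Δ.Chamber C)
    (hD : Δ.Chamber D) (hE : Δ.Chamber E) (hDE : leOfRes Δ R C D E) (hED : R C E ⊆ D) :
    D = E := by
  have hsub : R D E ⊆ D := (hR.r3 C D E hC hD hDE.to_reflTransGen).trans hED
  have hface : R D E ∈ Δ.faces := Δ.down_closed D hD.1 _ hsub
  refine (hR.r2 D hD _ hface).unique ⟨hD, ?_, hsub⟩ ⟨hE, Finset.Subset.refl _, hR.r1b D E hD hE⟩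
  simp [hR.r1a D hD]

theorem le_antisymm (hR : ResAxioms Δ R) {C D E : Finset V} (hC : Δ.Chamber C)
    (hDE : leOfRes Δ R C D E) (hED : leOfRes Δ R C E D) : D = E := by
  replace hED := hED.to_reflTransGen
  induction hED using Relation.ReflTransGen.head_induction_on with
  | refl => rfl
  | head hstep _ ih =>
    obtain rfl := ih (hDE.tail hstep)
    exact hR.eq_of_le_of_subset hC hstep.2.1 hstep.1 hDE hstep.2.2

theorem le_of_le_of_le (hR : ResAxioms Δ R) {C D D₁ D₂ : Finset V} (hC : Δ.Chamber C)
    (h : leOfRes Δ R C D D₁) (h' : leOfRes Δ R C D₁ D₂) : leOfRes Δ R D D₁ D₂ := by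
  have hD : Δ.Chamber D := by
    obtain ⟨_, hstep, _⟩ := Relation.TransGen.head'_iff.1 h
    exact hstep.1
  have step : ∀ {X Y}, leOfRes Δ R C D X → Δ.Chamber X ∧ Δ.Chamber Y ∧ R C X ⊆ Y →
      Δ.Chamber X ∧ Δ.Chamber Y ∧ R D X ⊆ Y := fun hX hs =>
    ⟨hs.1, hs.2.1, (hR.r3 C D _ hC hD hX.to_reflTransGen).trans hs.2.2⟩
  induction h' with
  | single hs => exact .single (step h hs)
  | tail hX hs ih => exact ih.tail (step (h.trans hX) hs)

/-- Every linear extension of `≤_C` is a shelling. -/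
theorem isShelling (hR : ResAxioms Δ R) {C : Finset V} (hC : Δ.Chamber C)
    {r : Finset V → Finset V → Prop} (hr : LinOrderOn Δ r)
    (hext : ∀ D E, leOfRes Δ R C D E → r D E) : IsShelling Δ r := by
  refine ⟨hr, fun D hD ⟨E₀, hE₀, hne₀, hr₀⟩ => ⟨⟨∅, by simp, E₀, hE₀, hne₀, hr₀, by simp⟩, ?_⟩⟩
  refine fun F hF => ⟨?_, ?_⟩
  · rintro ⟨E, hE, hne, hrE, hFE⟩
    have hnot : ¬ R C D ⊆ F := fun h =>
      hne (hr.2.1 E D hE hD hrE (hext _ _ (.single ⟨hD, hE, h.trans hFE⟩)))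
    obtain ⟨x, hxR, hxF⟩ := Finset.not_subset.1 hnot
    have hxD : x ∈ D := hR.r1b C D hC hD hxR
    have hGD : D.erase x ⊆ D := Finset.erase_subset _ _
    obtain ⟨E', ⟨hE', hRE', hGE'⟩, -⟩ := hR.r2 C hC _ (Δ.down_closed D hD.1 _ hGD)
    refine ⟨D.erase x, ⟨hGD, Finset.card_erase_add_one hxD⟩,
      Finset.subset_erase.2 ⟨hF, hxF⟩, E', hE', ?_,
      hext _ _ (.single ⟨hE', hD, hRE'.trans hGD⟩), hGE'⟩
    rintro rfl
    exact Finset.notMem_erase _ _ (hRE' hxR)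
  · rintro ⟨G, -, hFG, E, hE, hne, hrE, hGE⟩
    exact ⟨E, hE, hne, hrE, hFG.trans hGE⟩

end ResAxioms

/-- (R) ⟹ (S): given restriction maps satisfying the restriction axioms, the
transitive closures `≤_C` are partial orders on the chambers and satisfy the
shelling axioms (S1), (S2), (S3). -/
theorem stmt_1 {V : Type*} [DecidableEq V] (Δ : Cplx V) (d : ℕ)
    (hpure : Δ.Pure (d + 1))
    (R : Finset V → Finset V → Finset V) (hR : ResAxioms Δ R) :
    -- each `≤_C` is a partial order on the set of chambers
    (∀ C, Δ.Chamber C →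
      (∀ D, Δ.Chamber D → leOfRes Δ R C D D) ∧
      (∀ D E, leOfRes Δ R C D E → leOfRes Δ R C E D → D = E) ∧
      (∀ D E F, leOfRes Δ R C D E → leOfRes Δ R C E F → leOfRes Δ R C D F)) ∧
    -- (S1): for every face `F`, the restriction of `≤_C` to the chambers
    -- containing `F` has a unique minimal element, ...
    (∀ C, Δ.Chamber C → ∀ F ∈ Δ.faces,
      ∃! D, Δ.Chamber D ∧ F ⊆ D ∧
        ∀ E, Δ.Chamber E → F ⊆ E → leOfRes Δ R C E D → E = D) ∧
    -- ... and for `F = ∅` this unique minimal element is `C` itself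
    (∀ C, Δ.Chamber C → ∀ E, Δ.Chamber E → leOfRes Δ R C E C → E = C) ∧
    -- (S2): every linear extension of `≤_C` is a shelling of `Δ`
    (∀ C, Δ.Chamber C → ∀ r, LinOrderOn Δ r →
      (∀ D E, leOfRes Δ R C D E → r D E) → IsShelling Δ r) ∧
    -- (S3): compatibility
    (∀ C D D₁ D₂, Δ.Chamber C → leOfRes Δ R C D D₁ → leOfRes Δ R C D₁ D₂ →
      leOfRes Δ R D D₁ D₂) := by
  refine ⟨fun C hC => ⟨fun D hD => .single ⟨hD, hD, hR.r1b C D hC hD⟩,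
    fun D E => hR.le_antisymm hC, fun D E F => .trans⟩, fun C hC F hF => ?_,
    fun C hC E hE hEC => ?_, fun C hC r hr hext => hR.isShelling hC hr hext,
    fun C D D₁ D₂ hC => hR.le_of_le_of_le hC⟩
  · obtain ⟨D, ⟨hD, hRD, hFD⟩, -⟩ := hR.r2 C hC F hF
    have hmin : ∀ E, Δ.Chamber E → F ⊆ E → leOfRes Δ R C D E := fun E hE hFE =>
      .single ⟨hD, hE, hRD.trans hFE⟩
    exact ⟨D, ⟨hD, hFD, fun E hE hFE hED => hR.le_antisymm hC hED (hmin E hE hFE)⟩,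
      fun E ⟨hE, hFE, hEmin⟩ => (hEmin D hD hFD (hmin E hE hFE)).symm⟩
  · exact hR.le_antisymm hC hEC (.single ⟨hC, hE, by simp [hR.r1a C hC]⟩)
end

section
/- Let Δ be a finite pure d-dimensional simplicial complex equipped with partial orders ≤_C on the set of chambers (one for each chamber C) satisfying the shelling axioms (S1), (S2′) and (S3). For a face F and a chamber C, define FC to be the unique minimal element of the restriction of ≤_C to the chambers containing F (which exists by (S1)). Then these projection maps satisfy the projection axioms (P1), (P2) and (P3). (Implication (S) ⟹ (P) of the main theorem, using only the weaker axiom (S2′).) -/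
open scoped Classical

/-- In a finite set carrying a partial order `r`, every element lies above a minimal one. -/
theorem Finset.exists_minimal_rel_le {α : Type*} (s : Finset α) (r : α → α → Prop)
    (hrefl : ∀ a ∈ s, r a a) (hantisymm : ∀ a b, r a b → r b a → a = b)
    (htrans : ∀ a b c, r a b → r b c → r a c) {a : α} (ha : a ∈ s) :
    ∃ m ∈ s, r m a ∧ ∀ b ∈ s, r b m → b = m := by
  let _ : PartialOrder s :=
    { le := fun x y => r x y
      le_refl := fun x => hrefl x x.2
      le_trans := fun x y z => htrans x y z
      le_antisymm := fun x y hxy hyx => Subtype.ext (hantisymm x y hxy hyx) }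
  obtain ⟨m, hma, hm⟩ := (Set.toFinite (Set.univ : Set s)).exists_le_minimal
    (Set.mem_univ (⟨a, ha⟩ : s))
  refine ⟨m, m.2, hma, fun b hb hbm => ?_⟩
  exact hantisymm _ _ hbm (hm.2 (Set.mem_univ (⟨b, hb⟩ : s)) hbm)

/-- (S) ⟹ (P), using only the weaker axiom (S2′): given partial orders `≤_C` on the
chambers satisfying (S1), (S2′) and (S3), the maps sending `(F, C)` to the unique
minimal element of `≤_C` restricted to the chambers containing `F` satisfy the
projection axioms. -/
theorem stmt_2 {V : Type*} [DecidableEq V] (Δ : Cplx V) (d : ℕ)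
    (hpure : Δ.Pure (d + 1))
    (le : Finset V → Finset V → Finset V → Prop)
    -- each `≤_C` is a partial order on the set of chambers
    (hrefl : ∀ C, Δ.Chamber C → ∀ D, Δ.Chamber D → le C D D)
    (hantisymm : ∀ C D E, Δ.Chamber C → le C D E → le C E D → D = E)
    (htrans : ∀ C D E F, Δ.Chamber C → le C D E → le C E F → le C D F)
    (hdom : ∀ C D E, Δ.Chamber C → le C D E → Δ.Chamber D ∧ Δ.Chamber E)
    -- (S1): unique minimal element among the chambers containing a face ...
    (hS1 : ∀ C, Δ.Chamber C → ∀ F ∈ Δ.faces,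
      ∃! D, Δ.Chamber D ∧ F ⊆ D ∧
        ∀ E, Δ.Chamber E → F ⊆ E → le C E D → E = D)
    -- ... which for the empty face is `C` itself
    (hS1empty : ∀ C, Δ.Chamber C → ∀ E, Δ.Chamber E → le C E C → E = C)
    -- (S2′): some linear extension of `≤_C` is a shelling of `Δ`
    (hS2' : ∀ C, Δ.Chamber C → ∃ r, LinOrderOn Δ r ∧
      (∀ D E, le C D E → r D E) ∧ IsShelling Δ r)
    -- (S3): compatibility
    (hS3 : ∀ C D D₁ D₂, Δ.Chamber C → le C D D₁ → le C D₁ D₂ → le D D₁ D₂)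
    -- `proj F C` is the unique minimal element of `≤_C` on the chambers containing `F`
    (proj : Finset V → Finset V → Finset V)
    (hproj : ∀ F ∈ Δ.faces, ∀ C, Δ.Chamber C →
      Δ.Chamber (proj F C) ∧ F ⊆ proj F C ∧
      ∀ E, Δ.Chamber E → F ⊆ E → le C E (proj F C) → E = proj F C) :
    ProjAxioms Δ proj := by
  have proj_unique : ∀ F ∈ Δ.faces, ∀ C, Δ.Chamber C → ∀ D, Δ.Chamber D → F ⊆ D →
      (∀ E, Δ.Chamber E → F ⊆ E → le C E D → E = D) → proj F C = D :=
    fun F hF C hC D hD hFD hmin =>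
      (hS1 C hC F hF).unique (hproj F hF C hC) ⟨hD, hFD, hmin⟩
  have proj_le : ∀ F ∈ Δ.faces, ∀ C, Δ.Chamber C → ∀ E, Δ.Chamber E → F ⊆ E →
      le C (proj F C) E := by
    intro F hF C hC E hE hFE
    have mem_iff : ∀ D, D ∈ Δ.faces.filter (fun D => Δ.Chamber D ∧ F ⊆ D) ↔
        Δ.Chamber D ∧ F ⊆ D := fun D => by
      rw [Finset.mem_filter]
      exact ⟨And.right, fun h => ⟨h.1.1, h⟩⟩
    obtain ⟨m, hm, hmE, hmin⟩ := Finset.exists_minimal_rel_le _ (le C)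
      (fun D hD => hrefl C hC D ((mem_iff D).1 hD).1) (fun D₁ D₂ => hantisymm C D₁ D₂ hC)
      (fun D₁ D₂ D₃ => htrans C D₁ D₂ D₃ hC) ((mem_iff E).2 ⟨hE, hFE⟩)
    rw [mem_iff] at hm
    rwa [proj_unique F hF C hC m hm.1 hm.2 fun D hD hFD => hmin D ((mem_iff D).2 ⟨hD, hFD⟩)]
  refine ⟨fun F hF C hC => (hproj F hF C hC).1, fun F hF C hC => (hproj F hF C hC).2.1,
    fun F hF C hC hFC => proj_unique F hF C hC C hC hFC fun E hE _ => hS1empty C hC E hE,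
    ?_, ?_, ?_⟩
  · intro F hF C G hC hFG hG
    obtain ⟨hD, -, hmin⟩ := hproj F hF C hC
    exact proj_unique G (Δ.down_closed _ hD.1 G hG) C hC _ hD hG
      fun E hE hGE => hmin E hE (hFG.trans hGE)
  · intro F hF C D hC hD hFD hfacets
    by_contra hne
    obtain ⟨hFC, hFFC, -⟩ := hproj F hF C hC
    obtain ⟨r, hr, hler, -, hshell⟩ := hS2' C hC
    have hrD : r (proj F C) D := hler _ _ (proj_le F hF C hC D hD hFD)
    obtain ⟨G, hGD, hFG, E, hE, hED, hrED, hGE⟩ :=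
      ((hshell D hD ⟨_, hFC, hne, hrD⟩).2 F hFD).1 ⟨_, hFC, hne, hrD, hFFC⟩
    have hDE : le C D E := by
      simpa only [hfacets G hFG hGD] using
        proj_le G (Δ.down_closed _ hD.1 G hGD.1) C hC E hE hGE
    exact hED (hr.2.1 E D hE hD hrED (hler D E hDE))
  · rintro F hF C C₁ _ hC hC₁ rfl hgallery
    obtain ⟨hD, hFD, -⟩ := hproj F hF C hC
    have hC₁D : le C C₁ (proj F C) := by
      induction hgallery using Relation.ReflTransGen.head_induction_on with
      | refl => exact hrefl C hC _ hD
      | head hadj _ ih =>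
        obtain ⟨-, hE, G, hG, -, hGE, rfl⟩ := hadj
        exact htrans C _ _ _ hC (proj_le G hG C hC _ hE hGE) (ih hE)
    exact proj_unique F hF C₁ hC₁ _ hD hFD fun E hE hFE hED =>
      hantisymm C₁ _ _ hC₁ hED (hS3 C C₁ _ E hC hC₁D (proj_le F hF C hC E hE hFE))
end

section
/- Let Δ be a finite chamber complex with the gate property. Then for every face F and chamber C there is a unique chamber containing F at minimal gallery distance from C; denoting this chamber FC, the resulting projection maps satisfy the projection axioms (P1), (P2) and (P3). (One direction of the theorem that a chamber complex, with the closest-chamber projections, satisfies the axioms if and only if it has the gate property.) -/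
open scoped Classical

namespace Cplx

variable {V : Type*} [DecidableEq V]

/-- Two distinct chambers are adjacent if they share a common facet. -/
def Adjacent (Δ : Cplx V) (D E : Finset V) : Prop :=
  Δ.Chamber D ∧ Δ.Chamber E ∧ D ≠ E ∧ ∃ G, G ⊆ D ∧ G ⊆ E ∧ G.card + 1 = D.card

/-- There is a gallery of length `k` from `D` to `E`. -/
def HasGallery (Δ : Cplx V) (D E : Finset V) (k : ℕ) : Prop :=
  ∃ g : ℕ → Finset V, g 0 = D ∧ g k = E ∧ (∀ i, i ≤ k → Δ.Chamber (g i)) ∧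
    ∀ i, i < k → Δ.Adjacent (g i) (g (i + 1))

/-- The gallery distance between two chambers. -/
noncomputable def gdist (Δ : Cplx V) (D E : Finset V) : ℕ :=
  sInf {k | Δ.HasGallery D E k}

/-- `Δ` is gallery connected. -/
def GalleryConnected (Δ : Cplx V) : Prop :=
  ∀ D E, Δ.Chamber D → Δ.Chamber E → ∃ k, Δ.HasGallery D E k

/-- The gate property: for every face `F` and chamber `C` there is a chamber `D ⊇ F`
with `d(C,E) = d(C,D) + d(D,E)` for every chamber `E ⊇ F`. -/
def GateProperty (Δ : Cplx V) : Prop :=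
  ∀ F ∈ Δ.faces, ∀ C, Δ.Chamber C → ∃ D, Δ.Chamber D ∧ F ⊆ D ∧
    ∀ E, Δ.Chamber E → F ⊆ E → Δ.gdist C E = Δ.gdist C D + Δ.gdist D E

end Cplx

namespace Cplx

section Galleries

variable {V : Type*} [DecidableEq V] {Δ : Cplx V} {n : ℕ}

theorem Adjacent.symm (hpure : Δ.Pure n) {D E : Finset V} (h : Δ.Adjacent D E) :
    Δ.Adjacent E D := by
  obtain ⟨hD, hE, hne, G, hGD, hGE, hc⟩ := h
  refine ⟨hE, hD, hne.symm, G, hGE, hGD, ?_⟩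
  rw [hc, hpure D hD, hpure E hE]

theorem hasGallery_refl {D : Finset V} (hD : Δ.Chamber D) : Δ.HasGallery D D 0 :=
  ⟨fun _ => D, rfl, rfl, fun _ _ => hD, fun _ hi => absurd hi (Nat.not_lt_zero _)⟩

theorem HasGallery.eq_of_zero {D E : Finset V} (h : Δ.HasGallery D E 0) : D = E := by
  obtain ⟨g, h0, h1, -⟩ := h
  exact h0.symm.trans h1

theorem HasGallery.snoc {D E E' : Finset V} {k : ℕ} (h : Δ.HasGallery D E k)
    (ha : Δ.Adjacent E E') : Δ.HasGallery D E' (k + 1) := by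
  obtain ⟨g, h0, hk, hch, hadj⟩ := h
  refine ⟨fun i => if i ≤ k then g i else E', by simpa using h0, by simp, ?_, ?_⟩
  · intro i _
    by_cases hi : i ≤ k
    · simpa [hi] using hch i hi
    · simpa [hi] using ha.2.1
  · intro i hi
    rcases Nat.lt_succ_iff_lt_or_eq.mp hi with hlt | rfl
    · simpa [hlt.le, Nat.succ_le_of_lt hlt] using hadj i hlt
    · simpa [hk] using ha

theorem HasGallery.exists_penultimate {D E : Finset V} {k : ℕ}
    (h : Δ.HasGallery D E (k + 1)) : ∃ E', Δ.HasGallery D E' k ∧ Δ.Adjacent E' E := by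
  obtain ⟨g, h0, hk, hch, hadj⟩ := h
  refine ⟨g k, ⟨g, h0, rfl, fun i hi => hch i (by omega), fun i hi => hadj i (by omega)⟩, ?_⟩
  rw [← hk]
  exact hadj k (by omega)

theorem HasGallery.append {D E : Finset V} {j : ℕ} (h : Δ.HasGallery D E j) {k : ℕ} :
    ∀ {E' : Finset V}, Δ.HasGallery E E' k → Δ.HasGallery D E' (j + k) := by
  induction k with
  | zero =>
    intro E' h'
    rwa [← h'.eq_of_zero]
  | succ k ih =>
    intro E' h'
    obtain ⟨E₁, h₁, ha⟩ := h'.exists_penultimate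
    exact (ih h₁).snoc ha

theorem HasGallery.symm (hpure : Δ.Pure n) {D : Finset V} (hD : Δ.Chamber D) {k : ℕ} :
    ∀ {E : Finset V}, Δ.HasGallery D E k → Δ.HasGallery E D k := by
  induction k with
  | zero =>
    intro E h
    rw [← h.eq_of_zero]
    exact hasGallery_refl hD
  | succ k ih =>
    intro E h
    obtain ⟨E₁, h₁, ha⟩ := h.exists_penultimate
    have := ((hasGallery_refl ha.2.1).snoc (ha.symm hpure)).append (ih h₁)
    rwa [show 0 + 1 + k = k + 1 by omega] at this

theorem gdist_le {D E : Finset V} {k : ℕ} (h : Δ.HasGallery D E k) : Δ.gdist D E ≤ k :=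
  Nat.sInf_le h

theorem GalleryConnected.hasGallery_gdist (hconn : Δ.GalleryConnected) {D E : Finset V}
    (hD : Δ.Chamber D) (hE : Δ.Chamber E) : Δ.HasGallery D E (Δ.gdist D E) :=
  Nat.sInf_mem (hconn D E hD hE)

theorem gdist_self {D : Finset V} (hD : Δ.Chamber D) : Δ.gdist D D = 0 :=
  Nat.le_zero.mp (gdist_le (hasGallery_refl hD))

theorem GalleryConnected.eq_of_gdist_eq_zero (hconn : Δ.GalleryConnected) {D E : Finset V}
    (hD : Δ.Chamber D) (hE : Δ.Chamber E) (h : Δ.gdist D E = 0) : D = E := by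
  have hg := hconn.hasGallery_gdist hD hE
  rw [h] at hg
  exact hg.eq_of_zero

theorem GalleryConnected.gdist_triangle (hconn : Δ.GalleryConnected) {C D E : Finset V}
    (hC : Δ.Chamber C) (hD : Δ.Chamber D) (hE : Δ.Chamber E) :
    Δ.gdist C E ≤ Δ.gdist C D + Δ.gdist D E :=
  gdist_le ((hconn.hasGallery_gdist hC hD).append (hconn.hasGallery_gdist hD hE))

theorem GalleryConnected.gdist_comm (hconn : Δ.GalleryConnected) (hpure : Δ.Pure n)
    {D E : Finset V} (hD : Δ.Chamber D) (hE : Δ.Chamber E) : Δ.gdist D E = Δ.gdist E D :=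
  le_antisymm (gdist_le ((hconn.hasGallery_gdist hE hD).symm hpure hE))
    (gdist_le ((hconn.hasGallery_gdist hD hE).symm hpure hD))

theorem Adjacent.gdist_le_one {D E : Finset V} (h : Δ.Adjacent D E) : Δ.gdist D E ≤ 1 :=
  gdist_le ((hasGallery_refl h.1).snoc h)

/-- If a chamber is adjacent to an end of a geodesic between two chambers of the star of `F`
and lies on that geodesic, then it contains `F`. -/
theorem GateProperty.subset_of_adjacent (hgate : Δ.GateProperty)
    (hconn : Δ.GalleryConnected) (hpure : Δ.Pure n) {F D D' E : Finset V}
    (hF : F ∈ Δ.faces) (hD : Δ.Chamber D) (hD' : Δ.Chamber D') (hFD : F ⊆ D) (hFD' : F ⊆ D')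
    (ha : Δ.Adjacent E D) (hlt : Δ.gdist D' E < Δ.gdist D' D) : F ⊆ E := by
  by_contra hFE
  obtain ⟨P, hP, hFP, hgP⟩ := hgate F hF E ha.1
  have hEP : Δ.gdist E P ≠ 0 := fun h =>
    hFE (hconn.eq_of_gdist_eq_zero ha.1 hP h ▸ hFP)
  have hED := hgP D hD hFD
  have hle := ha.gdist_le_one
  have hPD : P = D := hconn.eq_of_gdist_eq_zero hP hD (by omega)
  have hED' := hgP D' hD' hFD'
  rw [hPD, hconn.gdist_comm hpure ha.1 hD', hconn.gdist_comm hpure hD hD'] at hED'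
  omega

/-- A chamber of the star of `F` closest to `C` is a gate. -/
theorem GateProperty.gdist_eq_add (hgate : Δ.GateProperty) (hconn : Δ.GalleryConnected)
    {F C D : Finset V} (hF : F ∈ Δ.faces) (hC : Δ.Chamber C) (hD : Δ.Chamber D) (hFD : F ⊆ D)
    (hmin : ∀ E, Δ.Chamber E → F ⊆ E → Δ.gdist C D ≤ Δ.gdist C E) {E : Finset V}
    (hE : Δ.Chamber E) (hFE : F ⊆ E) : Δ.gdist C E = Δ.gdist C D + Δ.gdist D E := by
  obtain ⟨P, hP, hFP, hgP⟩ := hgate F hF C hC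
  have h₁ := hgP D hD hFD
  have h₂ := hmin P hP hFP
  have hPD : P = D := hconn.eq_of_gdist_eq_zero hP hD (by omega)
  rw [← hPD]
  exact hgP E hE hFE

theorem GateProperty.eq_of_closest (hgate : Δ.GateProperty) (hconn : Δ.GalleryConnected)
    {F C D E : Finset V} (hF : F ∈ Δ.faces) (hC : Δ.Chamber C) (hD : Δ.Chamber D) (hFD : F ⊆ D)
    (hmin : ∀ E, Δ.Chamber E → F ⊆ E → Δ.gdist C D ≤ Δ.gdist C E)
    (hE : Δ.Chamber E) (hFE : F ⊆ E) (hle : Δ.gdist C E ≤ Δ.gdist C D) : D = E := by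
  have h := hgate.gdist_eq_add hconn hF hC hD hFD hmin hE hFE
  exact hconn.eq_of_gdist_eq_zero hD hE (by omega)

end Galleries

end Cplx

/-- A finite chamber complex (gallery connected pure complex) with the gate property:
for every face `F` and chamber `C` there is a unique chamber containing `F` at minimal
gallery distance from `C`, and any choice of such closest chambers yields projection
maps satisfying the projection axioms (P1), (P2) and (P3). -/
theorem stmt_3 {V : Type*} [DecidableEq V] (Δ : Cplx V) (d : ℕ)
    (hpure : Δ.Pure (d + 1)) (hconn : Cplx.GalleryConnected Δ)
    (hgate : Cplx.GateProperty Δ) :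
    (∀ F ∈ Δ.faces, ∀ C, Δ.Chamber C →
      ∃! D, Δ.Chamber D ∧ F ⊆ D ∧
        ∀ E, Δ.Chamber E → F ⊆ E → Δ.gdist C D ≤ Δ.gdist C E) ∧
    (∀ proj : Finset V → Finset V → Finset V,
      (∀ F ∈ Δ.faces, ∀ C, Δ.Chamber C →
        Δ.Chamber (proj F C) ∧ F ⊆ proj F C ∧
        ∀ E, Δ.Chamber E → F ⊆ E → Δ.gdist C (proj F C) ≤ Δ.gdist C E) →
      ProjAxioms Δ proj) := by
  refine ⟨fun F hF C hC => ?_, fun proj hproj => ?_⟩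
  · obtain ⟨D, hD, hFD, hg⟩ := hgate F hF C hC
    have hmin : ∀ E, Δ.Chamber E → F ⊆ E → Δ.gdist C D ≤ Δ.gdist C E := fun E hE hFE => by
      rw [hg E hE hFE]
      exact Nat.le_add_right _ _
    refine ⟨D, ⟨hD, hFD, hmin⟩, fun E hE => ?_⟩
    exact (hgate.eq_of_closest hconn hF hC hD hFD hmin hE.1 hE.2.1 (hE.2.2 D hD hFD)).symm
  have hch := fun F hF C hC => (hproj F hF C hC).1
  have hsub := fun F hF C hC => (hproj F hF C hC).2.1
  have hmin := fun F hF C hC => (hproj F hF C hC).2.2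
  have hadd : ∀ F ∈ Δ.faces, ∀ C, Δ.Chamber C → ∀ E, Δ.Chamber E → F ⊆ E →
      Δ.gdist C E = Δ.gdist C (proj F C) + Δ.gdist (proj F C) E := fun F hF C hC E hE hFE =>
    hgate.gdist_eq_add hconn hF hC (hch F hF C hC) (hsub F hF C hC) (hmin F hF C hC) hE hFE
  have huniq : ∀ F ∈ Δ.faces, ∀ C, Δ.Chamber C → ∀ E, Δ.Chamber E → F ⊆ E →
      Δ.gdist C E ≤ Δ.gdist C (proj F C) → proj F C = E := fun F hF C hC E hE hFE hle =>
    hgate.eq_of_closest hconn hF hC (hch F hF C hC) (hsub F hF C hC) (hmin F hF C hC) hE hFE hle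
  refine ⟨hch, hsub, ?_, ?_, ?_, ?_⟩
  · intro F hF C hC hFC
    refine huniq F hF C hC C hC hFC ?_
    rw [Cplx.gdist_self hC]
    exact Nat.zero_le _
  · intro F hF C G hC hFG hG
    have hGf : G ∈ Δ.faces := Δ.down_closed _ (hch F hF C hC).1 G hG
    exact huniq G hGf C hC _ (hch F hF C hC) hG
      (hmin F hF C hC _ (hch G hGf C hC) (hFG.trans (hsub G hGf C hC)))
  · intro F hF C D hC hD hFD hfacets
    by_contra hne
    have hP := hch F hF C hC
    have hCD := hadd F hF C hC D hD hFD
    obtain ⟨k, hk⟩ := Nat.exists_eq_succ_of_ne_zero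
      (fun h => hne (hconn.eq_of_gdist_eq_zero hP hD h))
    have hgal := hconn.hasGallery_gdist hP hD
    rw [hk] at hgal
    obtain ⟨E, hPE, ha⟩ := hgal.exists_penultimate
    have hPEk := Cplx.gdist_le hPE
    have hFE : F ⊆ E := hgate.subset_of_adjacent hconn hpure hF hD hP hFD
      (hsub F hF C hC) ha (by omega)
    obtain ⟨hE, -, hED, G, hGE, hGD, hcard⟩ := ha
    have hcardED : E.card = D.card := by rw [hpure E hE, hpure D hD]
    have hlt : (E ∩ D).card < E.card := by
      refine Finset.card_lt_card (Finset.ssubset_iff_subset_ne.mpr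
        ⟨Finset.inter_subset_left, fun h => hED ?_⟩)
      exact Finset.eq_of_subset_of_card_le (Finset.inter_eq_left.mp h) hcardED.ge
    have hG : G = E ∩ D :=
      Finset.eq_of_subset_of_card_le (Finset.subset_inter hGE hGD) (by omega)
    have hGf : G ∈ Δ.faces := Δ.down_closed D hD.1 G hGD
    have hGC := hfacets G (hG ▸ Finset.subset_inter hFE hFD) ⟨hGD, by omega⟩
    have hle := hmin G hGf C hC E hE hGE
    rw [hGC] at hle
    have htri := hconn.gdist_triangle hC hP hE
    omega
  · intro F hF C C₁ D hC hC₁ hD hgal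
    have hDch : Δ.Chamber D := hD ▸ hch F hF C hC
    have hFD : F ⊆ D := hD ▸ hsub F hF C hC
    have hgeo : Δ.gdist C D = Δ.gdist C C₁ + Δ.gdist C₁ D := by
      induction hgal using Relation.ReflTransGen.head_induction_on with
      | refl => rw [Cplx.gdist_self hDch, Nat.add_zero]
      | head hw _ ih =>
        obtain ⟨hA, hB, G, hG, -, hGB, hGC⟩ := hw
        have h₁ := hadd G hG C hC _ hB hGB
        rw [hGC] at h₁
        have h₂ := ih hB
        have h₃ := hconn.gdist_triangle hA hB hDch
        have h₄ := hconn.gdist_triangle hC hA hDch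
        omega
    have hE := hch F hF C₁ hC₁
    have htri := hconn.gdist_triangle hC hC₁ hE
    have hle := hmin F hF C hC _ hE (hsub F hF C₁ hC₁)
    rw [hD] at hle
    exact huniq F hF C₁ hC₁ D hDch hFD (by omega)
end

section
/- Let Δ be a finite thin pure d-dimensional simplicial complex labelled by a finite set I and equipped with projection maps satisfying (P1), (P2) and (P3); define R_C(D) = {v ∈ D : (D ∖ {v})C ≠ D} and let ≤_C be the transitive closure of the relation E ⪯ D iff R_C(E) ≤ D. Let ¯ : C → C be any map on chambers. Then the following are equivalent: (P4) for every facet G of Δ (i.e. every codimension-1 face of a chamber) and every chamber C, GC ≠ GC̄; (R4) for all chambers C and D, the type of R_C(D) is the complement in I of the type of R_{C̄}(D); (S4) for every chamber C, the partial orders ≤_C and ≤_{C̄} are dual to each other, i.e. D ≤_C E iff E ≤_{C̄} D. -/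
open scoped Classical

namespace Cplx

variable {V : Type*} [DecidableEq V]

/-- `Δ` is thin: every facet of a chamber is contained in exactly two chambers. -/
def Thin (Δ : Cplx V) : Prop :=
  ∀ G D, Δ.Chamber D → Δ.IsFacetOf G D →
    ∃ D₁ D₂, D₁ ≠ D₂ ∧ Δ.Chamber D₁ ∧ Δ.Chamber D₂ ∧ G ⊆ D₁ ∧ G ⊆ D₂ ∧
      ∀ E, Δ.Chamber E → G ⊆ E → E = D₁ ∨ E = D₂

/-- A labelling of `Δ` by `I`: each vertex gets a type so that the vertices of
every chamber are mapped bijectively onto `I`. -/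
def IsLabelling (Δ : Cplx V) {I : Type*} (τ : V → I) : Prop :=
  ∀ D, Δ.Chamber D → Set.InjOn τ ↑D ∧ ∀ i : I, ∃ v ∈ D, τ v = i

end Cplx

/-- The partial order `≤_C` on chambers: the transitive closure of
`E ⪯ D` iff `R_C(E) ≤ D`. -/
def leOf {V : Type*} [DecidableEq V] (Δ : Cplx V)
    (proj : Finset V → Finset V → Finset V) (C : Finset V) :
    Finset V → Finset V → Prop :=
  Relation.TransGen (fun E D => Δ.Chamber E ∧ Δ.Chamber D ∧ resOf proj C E ⊆ D)

/-- The opposite axiom, projection version (P4). -/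
def OppP {V : Type*} [DecidableEq V] (Δ : Cplx V)
    (proj : Finset V → Finset V → Finset V) (opp : Finset V → Finset V) : Prop :=
  ∀ G D C, Δ.Chamber D → Δ.IsFacetOf G D → Δ.Chamber C →
    proj G C ≠ proj G (opp C)

/-- The opposite axiom, restriction version (R4): the type of `R_C(D)` is the
complement of the type of `R_{C̄}(D)`. -/
def OppR {V I : Type*} [DecidableEq V] [DecidableEq I] [Fintype I] (Δ : Cplx V)
    (proj : Finset V → Finset V → Finset V) (opp : Finset V → Finset V)
    (τ : V → I) : Prop :=
  ∀ C D, Δ.Chamber C → Δ.Chamber D →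
    (resOf proj C D).image τ = ((resOf proj (opp C) D).image τ)ᶜ

/-- The opposite axiom, shelling version (S4): `≤_C` and `≤_{C̄}` are dual. -/
def OppS {V : Type*} [DecidableEq V] (Δ : Cplx V)
    (proj : Finset V → Finset V → Finset V) (opp : Finset V → Finset V) : Prop :=
  ∀ C, Δ.Chamber C → ∀ D E, (leOf Δ proj C D E ↔ leOf Δ proj (opp C) E D)

theorem resOf_subset {V : Type*} [DecidableEq V] {proj : Finset V → Finset V → Finset V}
    {C D : Finset V} : resOf proj C D ⊆ D := fun _ hv => (mem_resOf.1 hv).1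

namespace Cplx

variable {V : Type*} [DecidableEq V] {Δ : Cplx V}

theorem Chamber.mem_faces_of_subset {D F : Finset V} (hD : Δ.Chamber D) (h : F ⊆ D) :
    F ∈ Δ.faces := Δ.down_closed D hD.1 F h

theorem isFacetOf_erase {D : Finset V} {v : V} (hv : v ∈ D) : Δ.IsFacetOf (D.erase v) D :=
  ⟨Finset.erase_subset _ _, Finset.card_erase_add_one hv⟩

theorem IsFacetOf.exists_eq_erase {D G : Finset V} (h : Δ.IsFacetOf G D) :
    ∃ v ∈ D, G = D.erase v := by
  have hcard : (D \ G).card = 1 := by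
    have := Finset.card_sdiff_add_card_eq_card h.1
    have := h.2
    omega
  obtain ⟨v, hv⟩ := Finset.card_eq_one.1 hcard
  have hmem : v ∈ D \ G := hv ▸ Finset.mem_singleton_self v
  rw [Finset.mem_sdiff] at hmem
  refine ⟨v, hmem.1, Finset.eq_of_subset_of_card_le (Finset.subset_erase.2 ⟨h.1, hmem.2⟩) ?_⟩
  have := Finset.card_erase_add_one hmem.1
  have := h.2
  omega

theorem Pure.isFacetOf {n : ℕ} (hpure : Δ.Pure n) {G D E : Finset V} (hD : Δ.Chamber D)
    (hG : Δ.IsFacetOf G D) (hE : Δ.Chamber E) (hGE : G ⊆ E) : Δ.IsFacetOf G E :=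
  ⟨hGE, by rw [hG.2, hpure D hD, hpure E hE]⟩

theorem Thin.exists_ne (hthin : Δ.Thin) {G D : Finset V} (hD : Δ.Chamber D)
    (hG : Δ.IsFacetOf G D) : ∃ E, Δ.Chamber E ∧ G ⊆ E ∧ E ≠ D := by
  obtain ⟨D₁, D₂, hne, h₁, h₂, hG₁, hG₂, -⟩ := hthin G D hD hG
  by_cases h : D₁ = D
  · exact ⟨D₂, h₂, hG₂, fun h' => hne (h.trans h'.symm)⟩
  · exact ⟨D₁, h₁, hG₁, h⟩

theorem Thin.eq_of_ne_of_ne (hthin : Δ.Thin) {G D X Y : Finset V} (hD : Δ.Chamber D)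
    (hG : Δ.IsFacetOf G D) (hX : Δ.Chamber X) (hGX : G ⊆ X) (hY : Δ.Chamber Y) (hGY : G ⊆ Y)
    (hXD : X ≠ D) (hYD : Y ≠ D) : X = Y := by
  obtain ⟨D₁, D₂, -, -, -, -, -, h⟩ := hthin G D hD hG
  have hD' := h D hD hG.1
  have hX' := h X hX hGX
  have hY' := h Y hY hGY
  grind

end Cplx

namespace ProjAxioms

variable {V : Type*} [DecidableEq V] {Δ : Cplx V} {proj : Finset V → Finset V → Finset V}

theorem proj_resOf (hP : ProjAxioms Δ proj) {C D : Finset V} (hC : Δ.Chamber C)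
    (hD : Δ.Chamber D) : proj (resOf proj C D) C = D := by
  refine hP.p2 _ (hD.mem_faces_of_subset resOf_subset) C D hC hD resOf_subset ?_
  intro G hRG hG
  obtain ⟨v, hv, rfl⟩ := hG.exists_eq_erase
  by_contra hne
  exact Finset.notMem_erase v D (hRG (mem_resOf.2 ⟨hv, hne⟩))

theorem resOf_subset_of_proj_eq (hP : ProjAxioms Δ proj) {C D F : Finset V}
    (hC : Δ.Chamber C) (hF : F ∈ Δ.faces) (h : proj F C = D) : resOf proj C D ⊆ F := by
  intro v hv
  rw [mem_resOf] at hv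
  by_contra hvF
  have hFD : F ⊆ D := h ▸ hP.p1i F hF C hC
  exact hv.2 ((hP.p1iii F hF C _ hC (Finset.subset_erase.2 ⟨hFD, hvF⟩)
    (h ▸ Finset.erase_subset v D)).trans h)

theorem leOf_of_proj_eq (hP : ProjAxioms Δ proj) {C D E F : Finset V}
    (hC : Δ.Chamber C) (hD : Δ.Chamber D) (hE : Δ.Chamber E) (hF : F ∈ Δ.faces)
    (h : proj F C = D) (hFE : F ⊆ E) : leOf Δ proj C D E :=
  .single ⟨hD, hE, (hP.resOf_subset_of_proj_eq hC hF h).trans hFE⟩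

theorem weakAdj_of_resOf_subset (hP : ProjAxioms Δ proj) {C D E : Finset V}
    (hC : Δ.Chamber C) (hD : Δ.Chamber D) (hE : Δ.Chamber E) (h : resOf proj C D ⊆ E) :
    Δ.WeakAdj proj C D E :=
  ⟨hD, hE, _, hD.mem_faces_of_subset resOf_subset, resOf_subset, h, hP.proj_resOf hC hD⟩

theorem proj_eq_of_leOf (hP : ProjAxioms Δ proj) {C D E F : Finset V} (hC : Δ.Chamber C)
    (hE : Δ.Chamber E) (hF : F ∈ Δ.faces) (h : proj F C = D) (hle : leOf Δ proj C E D) :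
    proj F E = D :=
  hP.p3 F hF C E D hC hE h <| Relation.ReflTransGen.mono (fun _ _ ⟨hX, hY, hXY⟩ =>
    hP.weakAdj_of_resOf_subset hC hX hY hXY) _ _ hle.to_reflTransGen

theorem eq_of_resOf_subset_of_leOf (hP : ProjAxioms Δ proj) {C D E : Finset V}
    (hC : Δ.Chamber C) (hD : Δ.Chamber D) (hE : Δ.Chamber E) (h : resOf proj C D ⊆ E)
    (hle : leOf Δ proj C E D) : E = D := by
  have hF := hD.mem_faces_of_subset (resOf_subset (proj := proj) (C := C))
  rw [← hP.proj_eq_of_leOf hC hE hF (hP.proj_resOf hC hD) hle, hP.p1ii _ hF E hE h]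

theorem leOf_antisymm (hP : ProjAxioms Δ proj) {C D E : Finset V} (hC : Δ.Chamber C)
    (hDE : leOf Δ proj C D E) (hED : leOf Δ proj C E D) : D = E := by
  induction hDE using Relation.TransGen.head_induction_on with
  | single h => exact (hP.eq_of_resOf_subset_of_leOf hC h.1 h.2.1 h.2.2 hED).symm
  | head h hle ih =>
    have heq := hP.eq_of_resOf_subset_of_leOf hC h.1 h.2.1 h.2.2 (hle.trans hED)
    exact heq.symm.trans (ih (heq ▸ hED))

/-- If a common face of `D` and `E` projects `C` to `D`, then there is a gallery from `D` to `E`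
in which every step ascends across a facet; hence `D` and `E` are related by every transitive
relation that holds along such steps. -/
theorem rel_of_proj_eq (hP : ProjAxioms Δ proj) {C D F : Finset V}
    (hC : Δ.Chamber C) (hF : F ∈ Δ.faces) (h : proj F C = D)
    {r : Finset V → Finset V → Prop} (htrans : ∀ X Y Z, r X Y → r Y Z → r X Z)
    (hrefl : ∀ X, Δ.Chamber X → r X X)
    (hstep : ∀ G X, Δ.Chamber X → Δ.IsFacetOf G X → proj G C ≠ X → r (proj G C) X)
    {E : Finset V} (hE : Δ.Chamber E) (hFE : F ⊆ E) : r D E := by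
  induction hn : (Δ.faces.filter fun X => leOf Δ proj C X E).card using Nat.strong_induction_on
    generalizing E with
  | _ n ih =>
  by_cases hED : E = D
  · exact hED ▸ hrefl E hE
  obtain ⟨G, hFG, hG, hne⟩ : ∃ G, F ⊆ G ∧ Δ.IsFacetOf G E ∧ proj G C ≠ E := by
    by_contra! hall
    exact hED ((hP.p2 F hF C E hC hE hFE hall).symm.trans h)
  have hGf := hE.mem_faces_of_subset hG.1
  have hE' := hP.chamber G hGf C hC
  have hle : leOf Δ proj C (proj G C) E := hP.leOf_of_proj_eq hC hE' hE hGf rfl hG.1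
  refine htrans _ _ _ (ih _ ?_ hE' (hFG.trans (hP.p1i G hGf C hC)) rfl) (hstep G E hE hG hne)
  rw [← hn]
  refine Finset.card_lt_card (Finset.ssubset_iff_of_subset ?_ |>.2 ⟨E, ?_, ?_⟩)
  · intro X hX
    rw [Finset.mem_filter] at hX ⊢
    exact ⟨hX.1, hX.2.trans hle⟩
  · exact Finset.mem_filter.2 ⟨hE.1, .single ⟨hE, hE, resOf_subset⟩⟩
  · exact fun hX => hne (hP.leOf_antisymm hC hle (Finset.mem_filter.1 hX).2)

theorem leOf_swap_of_proj_ne (hP : ProjAxioms Δ proj) (hthin : Δ.Thin) {C C' : Finset V}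
    (hC : Δ.Chamber C) (hC' : Δ.Chamber C')
    (hne : ∀ G D, Δ.Chamber D → Δ.IsFacetOf G D → proj G C ≠ proj G C') {D E : Finset V}
    (hle : leOf Δ proj C D E) : leOf Δ proj C' E D := by
  have hswap : ∀ X Y, Δ.Chamber X → Δ.Chamber Y → resOf proj C X ⊆ Y →
      leOf Δ proj C' Y X := by
    intro X Y hX hY hXY
    refine hP.rel_of_proj_eq (r := fun X Y => leOf Δ proj C' Y X) hC
      (hX.mem_faces_of_subset resOf_subset) (hP.proj_resOf hC hX)
      (fun _ _ _ h₁ h₂ => Relation.TransGen.trans h₂ h₁)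
      (fun Z hZ => .single ⟨hZ, hZ, resOf_subset⟩) ?_ hY hXY
    intro G Z hZ hG hGZ
    have hGf := hZ.mem_faces_of_subset hG.1
    have hGC := hP.chamber G hGf C hC
    have heq : proj G C' = Z := by
      by_contra hGZ'
      exact hne G Z hZ hG (hthin.eq_of_ne_of_ne hZ hG hGC (hP.p1i G hGf C hC)
        (hP.chamber G hGf C' hC') (hP.p1i G hGf C' hC') hGZ hGZ')
    exact hP.leOf_of_proj_eq hC' hZ hGC hGf heq (hP.p1i G hGf C hC)
  induction hle with
  | single h => exact hswap _ _ h.1 h.2.1 h.2.2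
  | tail _ h ih => exact (hswap _ _ h.1 h.2.1 h.2.2).trans ih

theorem oppR_of_oppP (hP : ProjAxioms Δ proj) (hthin : Δ.Thin) {I : Type*} [DecidableEq I]
    [Fintype I] {τ : V → I} (hτ : Δ.IsLabelling τ) {opp : Finset V → Finset V}
    (hopp : ∀ C, Δ.Chamber C → Δ.Chamber (opp C)) (h : OppP Δ proj opp) :
    OppR Δ proj opp τ := by
  intro C D hC hD
  have hmem : ∀ B v, v ∈ D → (τ v ∈ (resOf proj B D).image τ ↔ proj (D.erase v) B ≠ D) := by
    intro B v hv
    rw [Finset.mem_image]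
    constructor
    · rintro ⟨w, hw, hwv⟩
      rw [mem_resOf] at hw
      rw [← (hτ D hD).1 hw.1 hv hwv]
      exact hw.2
    · exact fun hne => ⟨v, mem_resOf.2 ⟨hv, hne⟩, rfl⟩
  ext i
  obtain ⟨v, hv, rfl⟩ := (hτ D hD).2 i
  rw [Finset.mem_compl, hmem C v hv, hmem (opp C) v hv, not_not]
  have hG : Δ.IsFacetOf (D.erase v) D := Cplx.isFacetOf_erase hv
  have hGf := hD.mem_faces_of_subset hG.1
  have hne := h _ D C hD hG hC
  constructor
  · intro h₁
    by_contra h₂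
    exact hne (hthin.eq_of_ne_of_ne hD hG (hP.chamber _ hGf C hC) (hP.p1i _ hGf C hC)
      (hP.chamber _ hGf _ (hopp C hC)) (hP.p1i _ hGf _ (hopp C hC)) h₁ h₂)
  · exact fun h₂ h₁ => hne (h₁.trans h₂.symm)

theorem oppP_of_oppR (hP : ProjAxioms Δ proj) {n : ℕ} (hpure : Δ.Pure n) {I : Type*}
    [DecidableEq I] [Fintype I] {τ : V → I} (hτ : Δ.IsLabelling τ)
    {opp : Finset V → Finset V} (h : OppR Δ proj opp τ) : OppP Δ proj opp := by
  intro G D C hD hG hC heq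
  have hGf := hD.mem_faces_of_subset hG.1
  have hE := hP.chamber G hGf C hC
  obtain ⟨v, hv, hGv⟩ := (hpure.isFacetOf hD hG hE (hP.p1i G hGf C hC)).exists_eq_erase
  have hnot : ∀ B, proj G B = proj G C → τ v ∉ (resOf proj B (proj G C)).image τ := by
    intro B hB hmem
    obtain ⟨w, hw, hwv⟩ := Finset.mem_image.1 hmem
    rw [mem_resOf] at hw
    rw [(hτ _ hE).1 hw.1 hv hwv, ← hGv] at hw
    exact hw.2 hB
  refine hnot C rfl ?_
  rw [h C _ hC hE, Finset.mem_compl]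
  exact hnot _ heq.symm

theorem oppS_of_oppP (hP : ProjAxioms Δ proj) (hthin : Δ.Thin) {opp : Finset V → Finset V}
    (hopp : ∀ C, Δ.Chamber C → Δ.Chamber (opp C)) (h : OppP Δ proj opp) :
    OppS Δ proj opp := fun C hC _ _ =>
  ⟨hP.leOf_swap_of_proj_ne hthin hC (hopp C hC) fun G D hD hG => h G D C hD hG hC,
    hP.leOf_swap_of_proj_ne hthin (hopp C hC) hC fun G D hD hG => (h G D C hD hG hC).symm⟩

theorem oppP_of_oppS (hP : ProjAxioms Δ proj) {n : ℕ} (hpure : Δ.Pure n) (hthin : Δ.Thin)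
    {opp : Finset V → Finset V} (hopp : ∀ C, Δ.Chamber C → Δ.Chamber (opp C))
    (h : OppS Δ proj opp) : OppP Δ proj opp := by
  intro G D C hD hG hC heq
  have hGf := hD.mem_faces_of_subset hG.1
  have hX := hP.chamber G hGf C hC
  obtain ⟨Y, hY, hGY, hYX⟩ :=
    hthin.exists_ne hX (hpure.isFacetOf hD hG hX (hP.p1i G hGf C hC))
  have hXY := hP.leOf_of_proj_eq hC hX hY hGf rfl hGY
  have hXY' := hP.leOf_of_proj_eq (hopp C hC) hX hY hGf heq.symm hGY
  exact hYX (hP.leOf_antisymm hC ((h C hC _ _).2 hXY') hXY)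

end ProjAxioms

/-- For a finite thin pure labelled complex with projection maps satisfying
(P1)-(P3) and a map `opp` on chambers, the three versions (P4), (R4), (S4)
of the opposite axiom are equivalent. -/
theorem stmt_5 {V I : Type*} [DecidableEq V] [DecidableEq I] [Fintype I]
    (Δ : Cplx V) (d : ℕ) (hpure : Δ.Pure (d + 1)) (hthin : Cplx.Thin Δ)
    (τ : V → I) (hτ : Cplx.IsLabelling Δ τ)
    (proj : Finset V → Finset V → Finset V) (hP : ProjAxioms Δ proj)
    (opp : Finset V → Finset V) (hopp : ∀ C, Δ.Chamber C → Δ.Chamber (opp C)) :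
    (OppP Δ proj opp ↔ OppR Δ proj opp τ) ∧
    (OppR Δ proj opp τ ↔ OppS Δ proj opp) := by
  have hPR : OppP Δ proj opp ↔ OppR Δ proj opp τ :=
    ⟨hP.oppR_of_oppP hthin hτ hopp, hP.oppP_of_oppR hpure hτ⟩
  exact ⟨hPR, hPR.symm.trans
    ⟨hP.oppS_of_oppP hthin hopp, hP.oppP_of_oppS hpure hthin hopp⟩⟩
end

section
/- Let Δ be a finite thin pure d-dimensional simplicial complex with a shelling ≤_S and associated restriction map R. Then the reverse linear order (in which D comes before E iff E <_S D) is also a shelling of Δ, and its restriction map R̄ satisfies R̄(D) = D ∖ R(D) for every chamber D. -/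
open scoped Classical

/-- The restriction map of a shelling order `r`:
`R(D) = {v ∈ D : D ∖ {v} ⊆ E for some chamber E earlier than D}`. -/
noncomputable def resMap {V : Type*} [DecidableEq V] (Δ : Cplx V)
    (r : Finset V → Finset V → Prop) (D : Finset V) : Finset V :=
  D.filter fun v => ∃ E, Δ.Chamber E ∧ E ≠ D ∧ r E D ∧ D.erase v ⊆ E

section

variable {V : Type*} [DecidableEq V]

/-- A linear order on the chambers is induced by an injective rank function. -/
theorem LinOrderOn.exists_rank {Δ : Cplx V} {r : Finset V → Finset V → Prop}
    (h : LinOrderOn Δ r) :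
    ∃ ρ : Finset V → ℕ,
      (∀ D E, Δ.Chamber D → Δ.Chamber E → ((E ≠ D ∧ r E D) ↔ ρ E < ρ D)) ∧
      (∀ D E, Δ.Chamber D → Δ.Chamber E → ρ D = ρ E → D = E) := by
  obtain ⟨_, hanti, htrans, htotal⟩ := h
  let ρ : Finset V → ℕ := fun D =>
    (Δ.faces.filter fun E => Δ.Chamber E ∧ E ≠ D ∧ r E D).card
  have hlt : ∀ D E, Δ.Chamber D → Δ.Chamber E → E ≠ D → r E D → ρ E < ρ D := by
    intro D E hD hE hne hr
    apply Finset.card_lt_card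
    rw [Finset.ssubset_iff_of_subset]
    · refine ⟨E, ?_, ?_⟩
      · simp [hE.1, hE, hne, hr]
      · simp
    · intro X hX
      simp only [Finset.mem_filter] at hX ⊢
      obtain ⟨hXf, hXc, hXne, hXr⟩ := hX
      refine ⟨hXf, hXc, ?_, htrans X E D hXc hE hD hXr hr⟩
      rintro rfl
      exact hne (hanti E X hE hXc hr hXr)
  refine ⟨ρ, fun D E hD hE => ⟨fun h => hlt D E hD hE h.1 h.2, fun h => ?_⟩, ?_⟩
  · have hne : E ≠ D := by
      rintro rfl
      exact lt_irrefl _ h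
    refine ⟨hne, (htotal E D hE hD).resolve_right fun hr => ?_⟩
    exact lt_asymm h (hlt E D hE hD hne.symm hr)
  · intro D E hD hE heq
    by_contra hne
    rcases htotal D E hD hE with hr | hr
    · exact absurd (hlt E D hE hD hne hr) (by omega)
    · exact absurd (hlt D E hD hE (Ne.symm hne) hr) (by omega)

/-- The boundary of the boundary of a simplex vanishes modulo two. -/
theorem sum_facets_containing_eq_zero {Δ : Cplx V} {d : ℕ} {E H : Finset V}
    (hE : E ∈ Δ.faces) (hEcard : E.card = d + 1) (hH : H.card + 1 = d) :
    ∑ G ∈ Δ.faces.filter (fun G => H ⊆ G ∧ G.card = d),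
      (if G ⊆ E then (1 : ZMod 2) else 0) = 0 := by
  by_cases hHE : H ⊆ E
  · have hcard : (E \ H).card = 2 := by
      rw [Finset.card_sdiff_of_subset hHE]
      omega
    obtain ⟨a, b, hab, hEH⟩ := Finset.card_eq_two.1 hcard
    have ha : a ∈ E \ H := by simp [hEH]
    have hb : b ∈ E \ H := by simp [hEH]
    rw [Finset.mem_sdiff] at ha hb
    rw [← Finset.sum_filter]
    have hset : (Δ.faces.filter (fun G => H ⊆ G ∧ G.card = d)).filter (fun G => G ⊆ E) =
        {insert a H, insert b H} := by
      ext G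
      simp only [Finset.mem_filter, Finset.mem_insert, Finset.mem_singleton]
      constructor
      · rintro ⟨⟨-, hHG, hG⟩, hGE⟩
        obtain ⟨x, hx⟩ : ∃ x, G \ H = {x} := by
          rw [← Finset.card_eq_one, Finset.card_sdiff_of_subset hHG]
          omega
        have hGx : G = insert x H := by
          rw [← Finset.sdiff_union_of_subset hHG, hx, Finset.insert_eq]
        have hxm : x ∈ G \ H := by simp [hx]
        rw [Finset.mem_sdiff] at hxm
        have hxE : x ∈ E \ H := Finset.mem_sdiff.2 ⟨hGE hxm.1, hxm.2⟩
        rw [hEH, Finset.mem_insert, Finset.mem_singleton] at hxE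
        rcases hxE with rfl | rfl
        · exact Or.inl hGx
        · exact Or.inr hGx
      · have key : ∀ x, x ∈ E ∧ x ∉ H → (insert x H ∈ Δ.faces ∧ H ⊆ insert x H ∧
            (insert x H).card = d) ∧ insert x H ⊆ E := by
          intro x hx
          have hsub : insert x H ⊆ E := Finset.insert_subset hx.1 hHE
          exact ⟨⟨Δ.down_closed E hE _ hsub, Finset.subset_insert _ _,
            by rw [Finset.card_insert_of_notMem hx.2, hH]⟩, hsub⟩
        rintro (rfl | rfl)
        · exact key a ha
        · exact key b hb
    have hne : insert a H ≠ insert b H := by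
      intro h
      have : a ∈ insert b H := h ▸ Finset.mem_insert_self a H
      rcases Finset.mem_insert.1 this with h | h
      · exact hab h
      · exact ha.2 h
    rw [hset, Finset.sum_pair hne]
    decide
  · apply Finset.sum_eq_zero
    intro G hG
    rw [if_neg]
    exact fun h => hHE ((Finset.mem_filter.1 hG).2.1.trans h)

/-- In the star of a face `F`, every codimension-one cycle modulo two supported on an initial
segment of a shelling bounds a chain of chambers in that segment. -/
theorem exists_chain_of_cycle {Δ : Cplx V} {d : ℕ} (hpure : Δ.Pure (d + 1))
    {ρ : Finset V → ℕ} (hinj : ∀ D E, Δ.Chamber D → Δ.Chamber E → ρ D = ρ E → D = E)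
    (hshell : ∀ D E F, Δ.Chamber D → Δ.Chamber E → ρ E < ρ D → F ⊆ D → F ⊆ E →
      ∃ G E', F ⊆ G ∧ G ⊆ D ∧ G.card = d ∧ Δ.Chamber E' ∧ ρ E' < ρ D ∧ G ⊆ E')
    (F : Finset V) (n : ℕ) (z : Finset V → ZMod 2)
    (hsupp : ∀ G, z G ≠ 0 → F ⊆ G ∧ G.card = d ∧ ∃ E, Δ.Chamber E ∧ ρ E < n ∧ G ⊆ E)
    (hcycle : ∀ H, F ⊆ H → H.card + 1 = d →
      ∑ G ∈ Δ.faces.filter (fun G => H ⊆ G ∧ G.card = d), z G = 0) :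
    ∃ c : Finset V → ZMod 2, (∀ E, c E ≠ 0 → ρ E < n) ∧
      ∀ G, F ⊆ G → G.card = d →
        z G = ∑ E ∈ Δ.faces.filter (fun E => Δ.Chamber E ∧ G ⊆ E), c E := by
  have hbit : ∀ x : ZMod 2, x ≠ 0 → x = 1 := by decide
  have hdouble : ∀ x : ZMod 2, x + x = 0 := by decide
  induction n generalizing z with
  | zero =>
    refine ⟨fun _ => 0, by simp, fun G _ _ => ?_⟩
    rw [Finset.sum_const_zero]
    by_contra h
    obtain ⟨_, _, E, _, hE, _⟩ := hsupp G h
    omega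
  | succ n ih =>
    by_cases hnew : ∀ G, z G ≠ 0 → ∃ E, Δ.Chamber E ∧ ρ E < n ∧ G ⊆ E
    · obtain ⟨c, hc, hz⟩ := ih z
        (fun G hG => ⟨(hsupp G hG).1, (hsupp G hG).2.1, hnew G hG⟩) hcycle
      exact ⟨c, fun E hE => (hc E hE).trans (Nat.lt_succ_self n), hz⟩
    push Not at hnew
    obtain ⟨G₀, hzG₀, hG₀new⟩ := hnew
    obtain ⟨hFG₀, hG₀card, E, hE, hρE, hG₀E⟩ := hsupp G₀ hzG₀
    have hρE : ρ E = n := by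
      by_contra hne
      exact hG₀new E hE (by omega) hG₀E
    let e : Finset V → ZMod 2 := fun G => if F ⊆ G ∧ G.card = d ∧ G ⊆ E then 1 else 0
    have hsupp' : ∀ G, z G + e G ≠ 0 →
        F ⊆ G ∧ G.card = d ∧ ∃ E, Δ.Chamber E ∧ ρ E < n ∧ G ⊆ E := by
      intro G hG
      have hbase : F ⊆ G ∧ G.card = d ∧ ∃ E, Δ.Chamber E ∧ ρ E < n + 1 ∧ G ⊆ E := by
        by_cases hz : z G = 0
        · by_cases h : F ⊆ G ∧ G.card = d ∧ G ⊆ E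
          · exact ⟨h.1, h.2.1, E, hE, by omega, h.2.2⟩
          · simp [hz, e, h] at hG
        · exact hsupp G hz
      refine ⟨hbase.1, hbase.2.1, ?_⟩
      by_contra hGnew
      push Not at hGnew
      obtain ⟨hFG, hGcard, E₁, hE₁, hρE₁, hGE₁⟩ := hbase
      have hE₁E : E₁ = E := by
        refine hinj E₁ E hE₁ hE ?_
        by_contra hne
        exact hGnew E₁ hE₁ (by omega) hGE₁
      subst hE₁E
      have heG : e G = 1 := if_pos ⟨hFG, hGcard, hGE₁⟩
      have hzG : z G = 0 := by
        by_contra h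
        rw [heG, hbit _ h] at hG
        exact hG (by decide)
      have hne : G ≠ G₀ := by
        rintro rfl
        exact hzG₀ hzG
      have hunion : G ∪ G₀ = E₁ := by
        apply Finset.eq_of_subset_of_card_le (Finset.union_subset hGE₁ hG₀E)
        rw [hpure E₁ hE₁]
        have hss : G ⊂ G ∪ G₀ := by
          refine Finset.ssubset_iff_subset_ne.2 ⟨Finset.subset_union_left, fun h => hne ?_⟩
          have : G₀ ⊆ G := by
            rw [h]
            exact Finset.subset_union_right
          exact (Finset.eq_of_subset_of_card_le this (by omega)).symm
        have := Finset.card_lt_card hss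
        omega
      have hHcard : (G ∩ G₀).card + 1 = d := by
        have := Finset.card_union_add_card_inter G G₀
        rw [hunion, hpure E₁ hE₁] at this
        omega
      have hbetween : ∀ G', G ∩ G₀ ⊆ G' → G'.card = d → G' ⊆ E₁ → G' = G ∨ G' = G₀ := by
        intro G' hHG' hG'card hG'E
        by_contra hcon
        push Not at hcon
        have hnot : ∀ {X : Finset V}, X.card = d → G' ≠ X → ∃ x ∈ X, x ∉ G' := by
          intro X hX hne'
          by_contra hall
          push Not at hall
          exact hne' (Finset.eq_of_subset_of_card_le hall (by omega)).symm
        obtain ⟨x, hxG, hx⟩ := hnot hGcard hcon.1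
        obtain ⟨y, hyG, hy⟩ := hnot hG₀card hcon.2
        have hxy : x ≠ y := by
          rintro rfl
          exact hx (hHG' (Finset.mem_inter.2 ⟨hxG, hyG⟩))
        have hle : (insert x (insert y G')).card ≤ E₁.card := Finset.card_le_card
          (Finset.insert_subset (hGE₁ hxG) (Finset.insert_subset (hG₀E hyG) hG'E))
        rw [Finset.card_insert_of_notMem (by simp [hxy, hx]),
          Finset.card_insert_of_notMem hy, hpure E₁ hE₁] at hle
        omega
      have hsum := hcycle (G ∩ G₀) (Finset.subset_inter hFG hFG₀) hHcard
      rw [Finset.sum_eq_single G₀] at hsum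
      · exact hzG₀ hsum
      · intro G' hG' hG'ne
        rw [Finset.mem_filter] at hG'
        obtain ⟨-, hHG', hG'card⟩ := hG'
        by_contra hz'
        obtain ⟨-, -, E₂, hE₂, hρE₂, hG'E₂⟩ := hsupp G' hz'
        rcases Nat.lt_or_ge (ρ E₂) n with hlt | hge
        · obtain ⟨G₁, E₃, hHG₁, hG₁E, hG₁card, hE₃, hρE₃, hG₁E₃⟩ :=
            hshell E₁ E₂ (G ∩ G₀) hE₁ hE₂ (by omega)
              (Finset.inter_subset_left.trans hGE₁) (hHG'.trans hG'E₂)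
          rcases hbetween G₁ hHG₁ hG₁card hG₁E with rfl | rfl
          · exact hGnew E₃ hE₃ (by omega) hG₁E₃
          · exact hG₀new E₃ hE₃ (by omega) hG₁E₃
        · obtain rfl := hinj E₂ E₁ hE₂ hE₁ (by omega)
          rcases hbetween G' hHG' hG'card hG'E₂ with rfl | rfl
          · exact hz' hzG
          · exact hG'ne rfl
      · intro h
        exact absurd (Finset.mem_filter.2 ⟨Δ.down_closed E₁ hE₁.1 _ hG₀E,
          Finset.inter_subset_right, hG₀card⟩) h
    obtain ⟨c, hc, hz⟩ := ih (fun G => z G + e G) hsupp' (by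
      intro H hFH hH
      rw [Finset.sum_add_distrib, hcycle H hFH hH, zero_add,
        ← sum_facets_containing_eq_zero hE.1 (hpure E hE) hH]
      refine Finset.sum_congr rfl fun G hG => ?_
      rw [Finset.mem_filter] at hG
      simp [e, hFH.trans hG.2.1, hG.2.2])
    refine ⟨fun X => c X + if X = E then 1 else 0, ?_, ?_⟩
    · intro X hX
      by_cases hXE : X = E
      · rw [hXE]
        omega
      · simp only [hXE, if_false, add_zero] at hX
        exact (hc X hX).trans (Nat.lt_succ_self n)
    · intro G hFG hG
      rw [Finset.sum_add_distrib, ← hz G hFG hG, Finset.sum_ite_eq']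
      have : e G = if E ∈ Δ.faces.filter (fun E => Δ.Chamber E ∧ G ⊆ E) then 1 else 0 := by
        simp [e, hFG, hG, hE, hE.1]
      rw [← this, add_assoc, hdouble, add_zero]

/-- If every facet of `D` containing `F` lies in an earlier chamber of a shelling of a thin
complex, then `D` is the last chamber containing `F`. -/
theorem rank_le_of_facets_earlier {Δ : Cplx V} {d : ℕ} (hpure : Δ.Pure (d + 1))
    (hthin : Δ.Thin) {ρ : Finset V → ℕ}
    (hinj : ∀ D E, Δ.Chamber D → Δ.Chamber E → ρ D = ρ E → D = E)
    (hshell : ∀ D E F, Δ.Chamber D → Δ.Chamber E → ρ E < ρ D → F ⊆ D → F ⊆ E →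
      ∃ G E', F ⊆ G ∧ G ⊆ D ∧ G.card = d ∧ Δ.Chamber E' ∧ ρ E' < ρ D ∧ G ⊆ E')
    {D E F : Finset V} (hD : Δ.Chamber D) (hE : Δ.Chamber E) (hFD : F ⊆ D) (hFE : F ⊆ E)
    (hsink : ∀ G, F ⊆ G → G ⊆ D → G.card = d → ∃ E', Δ.Chamber E' ∧ ρ E' < ρ D ∧ G ⊆ E') :
    ρ E ≤ ρ D := by
  have heq_of_add : ∀ x y : ZMod 2, x + y = 0 → x = y := by decide
  obtain ⟨c, hc, hz⟩ := exists_chain_of_cycle hpure hinj hshell F (ρ D)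
    (fun G => if F ⊆ G ∧ G.card = d ∧ G ⊆ D then 1 else 0)
    (by
      intro G hG
      obtain ⟨hFG, hGcard, hGD⟩ : F ⊆ G ∧ G.card = d ∧ G ⊆ D := by
        by_contra h
        exact hG (if_neg h)
      exact ⟨hFG, hGcard, hsink G hFG hGD hGcard⟩)
    (by
      intro H hFH hH
      refine (Finset.sum_congr rfl fun G hG => ?_).trans
        (sum_facets_containing_eq_zero hD.1 (hpure D hD) hH)
      rw [Finset.mem_filter] at hG
      simp [hFH.trans hG.2.1, hG.2.2])
  let c' : Finset V → ZMod 2 := fun X => c X + if X = D then 1 else 0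
  have hc' : ∀ G, F ⊆ G → G.card = d →
      ∑ X ∈ Δ.faces.filter (fun X => Δ.Chamber X ∧ G ⊆ X), c' X = 0 := by
    intro G hFG hG
    rw [Finset.sum_add_distrib, ← hz G hFG hG, Finset.sum_ite_eq']
    by_cases hGD : G ⊆ D
    · simp only [hFG, hG, hGD, hD, hD.1, Finset.mem_filter, and_self, if_true]
      decide
    · simp [hGD]
  have hadj : ∀ G X Y, F ⊆ G → G.card = d → Δ.Chamber X → Δ.Chamber Y → X ≠ Y →
      G ⊆ X → G ⊆ Y → c' X = c' Y := by
    intro G X Y hFG hG hX hY hXY hGX hGY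
    obtain ⟨D₁, D₂, hne, h1, h2, hG1, hG2, huniq⟩ := hthin G X hX
      ⟨hGX, by rw [hG, hpure X hX]⟩
    have hset : Δ.faces.filter (fun X => Δ.Chamber X ∧ G ⊆ X) = {D₁, D₂} := by
      ext Z
      simp only [Finset.mem_filter, Finset.mem_insert, Finset.mem_singleton]
      constructor
      · exact fun h => huniq Z h.2.1 h.2.2
      · rintro (rfl | rfl)
        · exact ⟨h1.1, h1, hG1⟩
        · exact ⟨h2.1, h2, hG2⟩
    have hsum := hc' G hFG hG
    rw [hset, Finset.sum_pair hne] at hsum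
    have h12 := heq_of_add _ _ hsum
    rcases huniq X hX hGX with rfl | rfl <;> rcases huniq Y hY hGY with rfl | rfl
    · rfl
    · exact h12
    · exact h12.symm
    · rfl
  have hconst : ∀ n X Y, ρ X + ρ Y ≤ n → Δ.Chamber X → Δ.Chamber Y → F ⊆ X → F ⊆ Y →
      c' X = c' Y := by
    intro n
    induction n with
    | zero =>
      intro X Y hn hX hY _ _
      rw [hinj X Y hX hY (by omega)]
    | succ n ih =>
      have step : ∀ X Y, ρ X + ρ Y ≤ n + 1 → Δ.Chamber X → Δ.Chamber Y → F ⊆ X → F ⊆ Y →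
          ρ Y < ρ X → c' X = c' Y := by
        intro X Y hn hX hY hFX hFY hlt
        obtain ⟨G, Z, hFG, hGX, hG, hZ, hρZ, hGZ⟩ := hshell X Y F hX hY hlt hFX hFY
        rw [hadj G X Z hFG hG hX hZ (by rintro rfl; omega) hGX hGZ]
        exact ih Z Y (by omega) hZ hY (hFG.trans hGZ) hFY
      intro X Y hn hX hY hFX hFY
      rcases lt_trichotomy (ρ X) (ρ Y) with h | h | h
      · exact (step Y X (by omega) hY hX hFY hFX h).symm
      · rw [hinj X Y hX hY h]
      · exact step X Y hn hX hY hFX hFY h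
  have hcD : c D = 0 := by
    by_contra h
    exact lt_irrefl _ (hc D h)
  have hED := hconst _ E D le_rfl hE hD hFE hFD
  by_cases h : E = D
  · rw [h]
  · simp only [c', h, hcD, if_true, if_false, add_zero, zero_add] at hED
    exact (hc E (by rw [hED]; decide)).le

/-- The second chamber through a facet of a chamber in a thin complex. -/
theorem Cplx.Thin.exists_unique_neighbor {Δ : Cplx V} (hthin : Δ.Thin) {G D : Finset V}
    (hD : Δ.Chamber D) (hG : Δ.IsFacetOf G D) :
    ∃ E, Δ.Chamber E ∧ E ≠ D ∧ G ⊆ E ∧ ∀ X, Δ.Chamber X → X ≠ D → G ⊆ X → X = E := by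
  obtain ⟨D₁, D₂, hne, h1, h2, hG1, hG2, huniq⟩ := hthin G D hD hG
  rcases huniq D hD hG.1 with rfl | rfl
  · exact ⟨D₂, h2, hne.symm, hG2, fun X hX hXD hGX => (huniq X hX hGX).resolve_left hXD⟩
  · exact ⟨D₁, h1, hne, hG1, fun X hX hXD hGX => (huniq X hX hGX).resolve_right hXD⟩

end

/-- For a finite thin pure complex, the reverse of a shelling is again a shelling,
and its restriction map is complementary to the original one:
`R̄(D) = D ∖ R(D)` for every chamber `D`. -/
theorem stmt_6 {V : Type*} [DecidableEq V] (Δ : Cplx V) (d : ℕ)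
    (hpure : Δ.Pure (d + 1)) (hthin : Cplx.Thin Δ)
    (r : Finset V → Finset V → Prop) (hshell : IsShelling Δ r) :
    IsShelling Δ (fun D E => r E D) ∧
    ∀ D, Δ.Chamber D → resMap Δ (fun D E => r E D) D = D \ resMap Δ r D := by
  obtain ⟨hlin, hsh⟩ := hshell
  obtain ⟨ρ, hρ, hinj⟩ := hlin.exists_rank
  obtain ⟨hrefl, hanti, htrans, htotal⟩ := hlin
  have hstep : ∀ D E F, Δ.Chamber D → Δ.Chamber E → ρ E < ρ D → F ⊆ D → F ⊆ E →
      ∃ G E', F ⊆ G ∧ G ⊆ D ∧ G.card = d ∧ Δ.Chamber E' ∧ ρ E' < ρ D ∧ G ⊆ E' := by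
    intro D E F hD hE hlt hFD hFE
    obtain ⟨hne, hr⟩ := (hρ D E hD hE).2 hlt
    obtain ⟨G, hG, hFG, E', hE', hne', hr', hGE'⟩ :=
      ((hsh D hD ⟨E, hE, hne, hr⟩).2 F hFD).1 ⟨E, hE, hne, hr, hFE⟩
    have := hpure D hD
    exact ⟨G, E', hFG, hG.1, by have := hG.2; omega, hE',
      (hρ D E' hD hE').1 ⟨hne', hr'⟩, hGE'⟩
  refine ⟨⟨⟨hrefl, fun D E hD hE h h' => hanti D E hD hE h' h,
    fun D E F hD hE hF h h' => htrans F E D hF hE hD h' h,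
    fun D E hD hE => htotal E D hE hD⟩, ?_⟩, ?_⟩
  · rintro D hD ⟨E₀, hE₀, hne₀, hr₀⟩
    refine ⟨⟨∅, Finset.empty_subset _, E₀, hE₀, hne₀, hr₀, Finset.empty_subset _⟩,
      fun F hFD => ⟨?_, ?_⟩⟩
    · rintro ⟨E, hE, hne, hr, hFE⟩
      by_contra hcon
      have hlt : ρ D < ρ E := (hρ E D hE hD).1 ⟨hne.symm, hr⟩
      refine absurd (rank_le_of_facets_earlier hpure hthin hinj hstep hD hE hFD hFE ?_)
        (by omega)
      intro G hFG hGD hG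
      have hfacet : Δ.IsFacetOf G D := ⟨hGD, by rw [hG, hpure D hD]⟩
      obtain ⟨X, hX, hXD, hGX, -⟩ := hthin.exists_unique_neighbor hD hfacet
      refine ⟨X, hX, (hρ D X hD hX).1 ⟨hXD, ?_⟩, hGX⟩
      exact (htotal X D hX hD).resolve_right fun h =>
        hcon ⟨G, hfacet, hFG, X, hX, hXD, h, hGX⟩
    · rintro ⟨G, -, hFG, E, hE, hne, hr, hGE⟩
      exact ⟨E, hE, hne, hr, hFG.trans hGE⟩
  · intro D hD
    ext v
    simp only [resMap, Finset.mem_filter, Finset.mem_sdiff]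
    refine and_congr_right fun hv => ?_
    obtain ⟨X, hX, hXD, hGX, huniq⟩ := hthin.exists_unique_neighbor hD
      (G := D.erase v) ⟨Finset.erase_subset _ _, Finset.card_erase_add_one hv⟩
    constructor
    · rintro ⟨E, hE, hne, hr, hGE⟩ ⟨-, E', hE', hne', hr', hGE'⟩
      obtain rfl := huniq E hE hne hGE
      obtain rfl := huniq E' hE' hne' hGE'
      exact hne (hanti E' D hE' hD hr' hr)
    · intro h
      refine ⟨X, hX, hXD, ?_, hGX⟩
      exact (htotal X D hX hD).resolve_left fun hr => h ⟨hv, X, hX, hXD, hr, hGX⟩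
end

section
/- Let S be a finite left regular band with identity and let rk : S → ℕ be a rank function. Suppose that for every x ∈ S and all i, j ∈ ℕ, the number N(c) = #{(F,G) ∈ S_x × S_x : rk F = i, rk G = j, FG = c} is the same for all chambers c of S_x (the uniformity condition (U) for every subsemigroup S_{≤X}). Then for all i, j ∈ ℕ and every H ∈ S, #{(F,G) ∈ S × S : rk F = i, rk G = j, FG = H} = #{(F,G) ∈ S × S : rk F = j, rk G = i, FG = H}; that is, σ_i σ_j = σ_j σ_i, where σ_k is the formal sum of all elements of rank k. -/
/-- Both factors of a chamber of `S_x` lie in `S_x`. -/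
theorem factors_mem_of_mul_chamber {S : Type*} [Monoid S] (hidem : ∀ x : S, x * x = x)
    (hlrb : ∀ x y : S, x * y * x = x * y) {x F G : S} (h : x * (F * G) = x) :
    x * F = x ∧ x * G = x := by
  constructor
  · calc x * F = x * (F * G * F) := by rw [← mul_assoc x, h]
      _ = x := by rw [hlrb, h]
  · calc x * G = x * (F * G) * G := by rw [h]
      _ = x * (F * (G * G)) := by simp only [mul_assoc]
      _ = x := by rw [hidem, h]

/-- In a left regular band, whether `F * G` is a chamber of `S_x` does not depend on the order of
the factors. -/
theorem chamber_mul_comm {S : Type*} [Monoid S] (hidem : ∀ x : S, x * x = x)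
    (hlrb : ∀ x y : S, x * y * x = x * y) {x F G : S}
    (h : x * (F * G) = x ∧ F * G * x = F * G) : x * (G * F) = x ∧ G * F * x = G * F := by
  obtain ⟨h₁, h₂⟩ := h
  obtain ⟨hF, hG⟩ := factors_mem_of_mul_chamber hidem hlrb h₁
  refine ⟨by rw [← mul_assoc, hG, hF], ?_⟩
  calc G * F * x = G * F * G * x := by rw [hlrb]
    _ = G * (F * G * x) := by simp only [mul_assoc]
    _ = G * F := by rw [h₂, ← mul_assoc, hlrb]

/-- Let `S` be a finite left regular band with identity (a finite monoid with
`x² = x` and `xyx = xy`) and `rk : S → ℕ` a rank function. If for every `x ∈ S`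
and all `i, j`, the number of pairs `(F, G) ∈ S_x × S_x` with `rk F = i`,
`rk G = j` and `FG = c` is the same for every chamber `c` of `S_x` (the
uniformity condition (U) for every `S_{≤X}`), then `σ_i σ_j = σ_j σ_i` for all
`i, j`: for every `H ∈ S` the number of pairs `(F, G)` with `rk F = i`,
`rk G = j`, `FG = H` equals the number with the ranks interchanged. -/
theorem stmt_12 (S : Type*) [Monoid S] [Fintype S]
    (hidem : ∀ x : S, x * x = x)
    (hlrb : ∀ x y : S, x * y * x = x * y)
    (rk : S → ℕ)
    (hU : ∀ x : S, ∀ i j : ℕ, ∀ c c' : S,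
      (x * c = x ∧ c * x = c) → (x * c' = x ∧ c' * x = c') →
      {p : S × S | x * p.1 = x ∧ x * p.2 = x ∧
        rk p.1 = i ∧ rk p.2 = j ∧ p.1 * p.2 = c}.ncard =
      {p : S × S | x * p.1 = x ∧ x * p.2 = x ∧
        rk p.1 = i ∧ rk p.2 = j ∧ p.1 * p.2 = c'}.ncard) :
    ∀ (i j : ℕ) (H : S),
      {p : S × S | rk p.1 = i ∧ rk p.2 = j ∧ p.1 * p.2 = H}.ncard =
      {p : S × S | rk p.1 = j ∧ rk p.2 = i ∧ p.1 * p.2 = H}.ncard := by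
  classical
  intro i j H
  set C : Finset S := Finset.univ.filter fun c => H * c = H ∧ c * H = c with hC
  have hmem : ∀ c, c ∈ C ↔ H * c = H ∧ c * H = c := by simp [hC]
  have hHC : H ∈ C := (hmem H).2 ⟨hidem H, hidem H⟩
  let P : ℕ → ℕ → Finset (S × S) := fun i j =>
    Finset.univ.filter fun p => rk p.1 = i ∧ rk p.2 = j ∧ p.1 * p.2 ∈ C
  have hfiber : ∀ i j, ∀ c ∈ C, ((P i j).filter fun p => p.1 * p.2 = c).card =
      {p : S × S | H * p.1 = H ∧ H * p.2 = H ∧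
        rk p.1 = i ∧ rk p.2 = j ∧ p.1 * p.2 = c}.ncard := by
    intro i j c hc
    rw [← Set.ncard_coe_finset]
    congr 1
    ext p
    simp only [P, Finset.coe_filter, Finset.mem_filter, Finset.mem_univ, true_and,
      Set.mem_ofPred_eq]
    constructor
    · rintro ⟨⟨hi, hj, hp⟩, rfl⟩
      obtain ⟨h₁, h₂⟩ := factors_mem_of_mul_chamber hidem hlrb ((hmem _).1 hp).1
      exact ⟨h₁, h₂, hi, hj, rfl⟩
    · rintro ⟨-, -, hi, hj, rfl⟩
      exact ⟨⟨hi, hj, hc⟩, rfl⟩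
  have hcard : ∀ i j, (P i j).card =
      C.card * {p : S × S | rk p.1 = i ∧ rk p.2 = j ∧ p.1 * p.2 = H}.ncard := by
    intro i j
    rw [Finset.card_eq_sum_card_fiberwise (f := fun p : S × S => p.1 * p.2) (t := C)
      fun p hp => (Finset.mem_filter.1 hp).2.2.2]
    refine Finset.sum_const_nat fun c hc => ?_
    rw [hfiber i j c hc, hU H i j c H ((hmem c).1 hc) ((hmem H).1 hHC)]
    congr 1
    ext p
    refine ⟨fun h => h.2.2, fun h => ?_⟩
    obtain ⟨h₁, h₂⟩ := factors_mem_of_mul_chamber hidem hlrb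
      (show H * (p.1 * p.2) = H by rw [h.2.2, hidem])
    exact ⟨h₁, h₂, h⟩
  have hswap : (P i j).card = (P j i).card := by
    have hmaps : ∀ i j, ∀ p ∈ P i j, p.swap ∈ P j i := by
      intro i j p hp
      obtain ⟨-, hi, hj, hp⟩ := Finset.mem_filter.1 hp
      exact Finset.mem_filter.2 ⟨Finset.mem_univ _, hj, hi,
        (hmem _).2 (chamber_mul_comm hidem hlrb ((hmem _).1 hp))⟩
    exact Finset.card_nbij' Prod.swap Prod.swap (hmaps i j) (hmaps j i)
      (fun p _ => p.swap_swap) (fun p _ => p.swap_swap)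
  rw [hcard, hcard] at hswap
  exact Nat.eq_of_mul_eq_mul_left (Finset.card_pos.2 ⟨H, hHC⟩) hswap
end

section
/- In the semigroup of ordered set partitions of [n] = {1,…,n} (the face semigroup of the Coxeter complex of type A_{n−1}), the rank sums commute: for all i, j and every ordered set partition H of [n], #{(F,G) : F has i blocks, G has j blocks, FG = H} = #{(F,G) : F has j blocks, G has i blocks, FG = H}; equivalently σ_i σ_j = σ_j σ_i in the semigroup algebra, where σ_k is the sum of all ordered set partitions with k blocks. (This is the type A_{n−1} case of the corollary that the Coxeter complexes of types A_{n−1} and B_n satisfy the commutativity conditions C_{i,j} for all i, j.) -/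
/-- An ordered set partition of `[n]`, encoded as a list of blocks. -/
abbrev OSP (n : ℕ) := List (Finset (Fin n))

/-- `P` is an ordered set partition of `[n]`: its blocks are nonempty, pairwise
disjoint, and their union is all of `[n]`. -/
def IsOSP {n : ℕ} (P : OSP n) : Prop :=
  (∀ B ∈ P, B.Nonempty) ∧
  List.Pairwise (fun B C => Disjoint B C) P ∧
  ∀ x : Fin n, ∃ B ∈ P, x ∈ B

/-- The product of ordered set partitions: refine the first by the second,
listing intersections `B_k ∩ C_l` in lexicographic order of `(k, l)` and
deleting empty intersections. -/
def OSPmul {n : ℕ} (P Q : OSP n) : OSP n :=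
  (P.flatMap fun B => Q.map fun C => B ∩ C).filter fun X => decide (X ≠ ∅)

/-- The list of fibers of `f`, ordered by value. -/
def fiberList {n k : ℕ} (f : Fin n → Fin k) : OSP n :=
  List.ofFn fun t => Finset.univ.filter fun x => f x = t

theorem fiberList_injective {n k : ℕ} :
    Function.Injective (fiberList : (Fin n → Fin k) → OSP n) := by
  intro f g hfg
  have h := List.ofFn_injective hfg
  funext x
  have hx : x ∈ Finset.univ.filter (fun y => g y = f x) := by
    rw [← congrFun h (f x)]; simp
  simpa using (Finset.mem_filter.1 hx).2.symm

theorem isOSP_fiberList {n k : ℕ} {f : Fin n → Fin k} (hf : Function.Surjective f) :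
    IsOSP (fiberList f) := by
  refine ⟨?_, ?_, fun x => ⟨_, List.mem_ofFn.2 ⟨f x, rfl⟩, by simp⟩⟩
  · intro B hB
    obtain ⟨t, rfl⟩ := List.mem_ofFn.1 hB
    obtain ⟨x, hx⟩ := hf t
    exact ⟨x, by simp [hx]⟩
  · refine List.pairwise_ofFn.2 fun s t hst => ?_
    refine Finset.disjoint_left.2 fun x hs ht => hst.ne ?_
    rw [← (Finset.mem_filter.1 hs).2, (Finset.mem_filter.1 ht).2]

theorem IsOSP.exists_eq_fiberList {n k : ℕ} {P : OSP n} (hP : IsOSP P) (hk : P.length = k) :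
    ∃ f : Fin n → Fin k, Function.Surjective f ∧ fiberList f = P := by
  subst hk
  obtain ⟨hne, hdis, hcov⟩ := hP
  have hex (x : Fin n) : ∃ t : Fin P.length, x ∈ P[t] := by
    obtain ⟨B, hB, hx⟩ := hcov x
    obtain ⟨t, ht⟩ := List.mem_iff_get.1 hB
    exact ⟨t, by simpa [← ht] using hx⟩
  choose f hf using hex
  have key (x : Fin n) (t : Fin P.length) (hx : x ∈ P[t]) : f x = t := by
    by_contra hne
    rcases lt_or_gt_of_ne hne with h | h
    · exact Finset.disjoint_left.1 (List.pairwise_iff_getElem.1 hdis _ _ _ _ h) (hf x) hx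
    · exact Finset.disjoint_left.1 (List.pairwise_iff_getElem.1 hdis _ _ _ _ h) hx (hf x)
  refine ⟨f, fun t => ?_, ?_⟩
  · obtain ⟨x, hx⟩ := hne P[t] (List.getElem_mem _)
    exact ⟨x, key x t hx⟩
  · refine List.ext_getElem (by simp [fiberList]) fun t h₁ h₂ => ?_
    ext x
    simp only [fiberList, List.getElem_ofFn, Finset.mem_filter, Finset.mem_univ, true_and]
    refine ⟨fun h => ?_, fun h => key x ⟨t, h₂⟩ h⟩
    have := hf x
    rw [h] at this
    exact this

/-- The elements of `S`, listed in lexicographic order. -/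
def lexList {i j : ℕ} (S : Finset (Fin i × Fin j)) : List (Fin i × Fin j) :=
  (List.finRange i ×ˢ List.finRange j).filter fun p => p ∈ S

theorem mem_lexList {i j : ℕ} {S : Finset (Fin i × Fin j)} {p : Fin i × Fin j} :
    p ∈ lexList S ↔ p ∈ S := by
  obtain ⟨k, l⟩ := p
  simp [lexList]

theorem nodup_lexList {i j : ℕ} (S : Finset (Fin i × Fin j)) : (lexList S).Nodup :=
  ((List.nodup_finRange i).product (List.nodup_finRange j)).filter _

theorem length_lexList {i j : ℕ} (S : Finset (Fin i × Fin j)) :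
    (lexList S).length = S.card := by
  rw [← List.toFinset_card_of_nodup (nodup_lexList S)]
  congr 1
  ext p
  simp [mem_lexList]

theorem OSPmul_fiberList {n i j : ℕ} (f : Fin n → Fin i) (g : Fin n → Fin j) :
    OSPmul (fiberList f) (fiberList g) =
      (lexList (Finset.univ.image fun x => (f x, g x))).map
        fun p => Finset.univ.filter fun x => (f x, g x) = p := by
  have hprod : ((fiberList f).flatMap fun B => (fiberList g).map fun C => B ∩ C) =
      (List.finRange i ×ˢ List.finRange j).map
        fun p => Finset.univ.filter fun x => (f x, g x) = p := by
    simp only [fiberList, List.ofFn_eq_map, SProd.sprod, List.product, List.map_flatMap,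
      List.flatMap_map, List.map_map]
    congr! 3 with k _ l
    ext x
    simp [Prod.ext_iff]
  rw [OSPmul, hprod, List.filter_map, lexList]
  congr 1
  refine List.filter_congr fun p _ => ?_
  simp [← Finset.nonempty_iff_ne_empty, Finset.filter_nonempty_iff]

theorem OSPmul_fiberList_eq_iff {n i j m : ℕ} (f : Fin n → Fin i) (g : Fin n → Fin j)
    {h : Fin n → Fin m} (hh : Function.Surjective h) :
    OSPmul (fiberList f) (fiberList g) = fiberList h ↔
      ∃ S : Finset (Fin i × Fin j), ∃ hS : S.card = m,
        ∀ x, (f x, g x) = (lexList S)[h x]'(by rw [length_lexList, hS]; exact (h x).2) := by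
  rw [OSPmul_fiberList]
  constructor
  · intro H
    have hlen := congrArg List.length H
    simp only [List.length_map, length_lexList, fiberList, List.length_ofFn] at hlen
    refine ⟨_, hlen, fun x => ?_⟩
    have hx : (fiberList h)[(h x : ℕ)]'(by simp [fiberList]) =
      Finset.univ.filter fun y => h y = h x := by simp [fiberList]
    have hmem : x ∈ (fiberList h)[(h x : ℕ)]'(by simp [fiberList]) := by simp [hx]
    simp only [← H, List.getElem_map] at hmem
    exact (Finset.mem_filter.1 hmem).2
  · rintro ⟨S, hS, H⟩
    have himg : Finset.univ.image (fun x => (f x, g x)) = S := by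
      ext p
      simp only [Finset.mem_image, Finset.mem_univ, true_and]
      constructor
      · rintro ⟨x, rfl⟩
        rw [H x]
        exact mem_lexList.1 (List.getElem_mem _)
      · intro hp
        obtain ⟨t, ht, rfl⟩ := List.mem_iff_getElem.1 (mem_lexList.2 hp)
        obtain ⟨x, hx⟩ := hh ⟨t, by rw [← hS, ← length_lexList]; exact ht⟩
        exact ⟨x, by simp [H x, hx]⟩
    rw [himg]
    refine List.ext_getElem (by simp [fiberList, length_lexList, hS]) fun t h₁ h₂ => ?_
    ext x
    simp [fiberList, H x, (nodup_lexList S).getElem_inj_iff, Fin.ext_iff]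

/-- The supports of `i × j` zero-one matrices with `m` ones and no zero row or column. -/
def fullSupports (i j m : ℕ) : Set (Finset (Fin i × Fin j)) :=
  {S | S.card = m ∧ (∀ k, ∃ l, (k, l) ∈ S) ∧ ∀ l, ∃ k, (k, l) ∈ S}

theorem ncard_fullSupports_comm (i j m : ℕ) :
    (fullSupports i j m).ncard = (fullSupports j i m).ncard := by
  refine Set.ncard_congr (fun S _ => S.map (Equiv.prodComm _ _).toEmbedding) ?_ ?_ ?_
  · rintro S ⟨h₁, h₂, h₃⟩
    exact ⟨by simpa using h₁, by simpa using h₃, by simpa using h₂⟩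
  · intro S S' _ _ h
    exact Finset.map_injective _ h
  · rintro S ⟨h₁, h₂, h₃⟩
    refine ⟨S.map (Equiv.prodComm _ _).toEmbedding,
      ⟨by simpa using h₁, by simpa using h₃, by simpa using h₂⟩, ?_⟩
    ext ⟨k, l⟩
    simp

theorem ncard_OSPmul_eq {n : ℕ} (i j : ℕ) {H : OSP n} (hH : IsOSP H) :
    {p : OSP n × OSP n | IsOSP p.1 ∧ IsOSP p.2 ∧
      p.1.length = i ∧ p.2.length = j ∧ OSPmul p.1 p.2 = H}.ncard =
    (fullSupports i j H.length).ncard := by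
  obtain ⟨h, hsurj, hfib⟩ := hH.exists_eq_fiberList rfl
  generalize H.length = m at h hsurj hfib ⊢
  subst hfib
  symm
  have hlt {S : Finset (Fin i × Fin j)} (hS : S ∈ fullSupports i j m) (x : Fin n) :
      (h x : ℕ) < (lexList S).length := by
    rw [length_lexList, hS.1]; exact (h x).2
  have hget {S : Finset (Fin i × Fin j)} (hS : S ∈ fullSupports i j m) {p} (hp : p ∈ S) :
      ∃ x, (lexList S)[h x]'(hlt hS x) = p := by
    obtain ⟨t, ht, rfl⟩ := List.mem_iff_getElem.1 (mem_lexList.2 hp)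
    obtain ⟨x, hx⟩ := hsurj ⟨t, by rw [← hS.1, ← length_lexList]; exact ht⟩
    exact ⟨x, by simp [hx]⟩
  refine Set.ncard_congr (fun S hS =>
    (fiberList fun x => ((lexList S)[h x]'(hlt hS x)).1,
      fiberList fun x => ((lexList S)[h x]'(hlt hS x)).2)) ?_ ?_ ?_
  · intro S hS
    refine ⟨isOSP_fiberList fun k => ?_, isOSP_fiberList fun l => ?_, by simp [fiberList],
      by simp [fiberList], (OSPmul_fiberList_eq_iff _ _ hsurj).2 ⟨S, hS.1, fun x => rfl⟩⟩
    · obtain ⟨l, hl⟩ := hS.2.1 k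
      obtain ⟨x, hx⟩ := hget hS hl
      exact ⟨x, by simp only [hx]⟩
    · obtain ⟨k, hk⟩ := hS.2.2 l
      obtain ⟨x, hx⟩ := hget hS hk
      exact ⟨x, by simp only [hx]⟩
  · intro S S' hS hS' heq
    rw [Prod.mk.injEq] at heq
    have h₁ := congrFun (fiberList_injective heq.1)
    have h₂ := congrFun (fiberList_injective heq.2)
    refine Finset.eq_of_subset_of_card_le (fun p hp => ?_) (by rw [hS.1, hS'.1])
    obtain ⟨x, rfl⟩ := hget hS hp
    rw [Prod.ext (h₁ x) (h₂ x)]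
    exact mem_lexList.1 (List.getElem_mem _)
  · rintro ⟨F, G⟩ ⟨hF, hG, hFi, hGj, hmul⟩
    dsimp only at hF hG hFi hGj hmul
    obtain ⟨f, hf, rfl⟩ := hF.exists_eq_fiberList hFi
    obtain ⟨g, hg, rfl⟩ := hG.exists_eq_fiberList hGj
    obtain ⟨S, hS, hfg⟩ := (OSPmul_fiberList_eq_iff f g hsurj).1 hmul
    have hmem (x : Fin n) : (f x, g x) ∈ S := by
      rw [hfg x]
      exact mem_lexList.1 (List.getElem_mem _)
    refine ⟨S, ⟨hS, fun k => ?_, fun l => ?_⟩, ?_⟩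
    · obtain ⟨x, rfl⟩ := hf k
      exact ⟨_, hmem x⟩
    · obtain ⟨x, rfl⟩ := hg l
      exact ⟨_, hmem x⟩
    · simp only [← hfg]

/-- In the face semigroup of the Coxeter complex of type `A_{n−1}` (ordered set
partitions of `[n]` under refinement product), the rank sums commute:
`σ_i σ_j = σ_j σ_i`, i.e. for every ordered set partition `H` the number of pairs
`(F, G)` of ordered set partitions with `i` resp. `j` blocks and `FG = H` equals
the number with `j` resp. `i` blocks. -/
theorem stmt_13 (n i j : ℕ) (H : OSP n) (hH : IsOSP H) :
    {p : OSP n × OSP n | IsOSP p.1 ∧ IsOSP p.2 ∧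
      p.1.length = i ∧ p.2.length = j ∧ OSPmul p.1 p.2 = H}.ncard =
    {p : OSP n × OSP n | IsOSP p.1 ∧ IsOSP p.2 ∧
      p.1.length = j ∧ p.2.length = i ∧ OSPmul p.1 p.2 = H}.ncard := by
  rw [ncard_OSPmul_eq i j hH, ncard_OSPmul_eq j i hH, ncard_fullSupports_comm]
end

section
/- Let Δ be a finite pure d-dimensional simplicial complex with a shelling ≤_S, and let F be a face of Δ. Then the restriction of ≤_S to the set of chambers containing F is a shelling of the subcomplex Δ_{≥F} consisting of all faces of chambers containing F: for every chamber D ⊇ F other than the ≤_S-first chamber containing F, the set of faces of D contained in some chamber E ⊇ F with E <_S D is nonempty and equals the set of faces contained in some facet G of D with F ≤ G and G contained in some chamber E <_S D. In particular, the link of any face of a shellable complex is shellable with the induced order. -/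
open scoped Classical

/-- A shelling of `Δ` restricts to a shelling of `Δ_{≥F}` (equivalently, the link
of any face of a shellable complex is shellable with the induced order): for every
chamber `D ⊇ F` other than the first chamber containing `F`, the set of faces of `D`
contained in some earlier chamber containing `F` is nonempty and equals the set of
faces contained in some facet `G` of `D` with `F ≤ G` and `G` contained in some
earlier chamber. -/
theorem stmt_14 {V : Type*} [DecidableEq V] (Δ : Cplx V) (d : ℕ)
    (hpure : Δ.Pure (d + 1))
    (r : Finset V → Finset V → Prop) (hshell : IsShelling Δ r)
    (F : Finset V) (hF : F ∈ Δ.faces) :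
    ∀ D, Δ.Chamber D → F ⊆ D →
      (∃ E, Δ.Chamber E ∧ F ⊆ E ∧ E ≠ D ∧ r E D) →
      ((∃ F', F' ⊆ D ∧ ∃ E, Δ.Chamber E ∧ F ⊆ E ∧ E ≠ D ∧ r E D ∧ F' ⊆ E) ∧
       (∀ F', F' ⊆ D →
         ((∃ E, Δ.Chamber E ∧ F ⊆ E ∧ E ≠ D ∧ r E D ∧ F' ⊆ E) ↔
          (∃ G, Δ.IsFacetOf G D ∧ F ⊆ G ∧ F' ⊆ G ∧
            ∃ E, Δ.Chamber E ∧ E ≠ D ∧ r E D ∧ G ⊆ E)))) := by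
  rintro D hD hFD ⟨E₀, hE₀, hFE₀, hne₀, hr₀⟩
  have hface := (hshell.2 D hD ⟨E₀, hE₀, hne₀, hr₀⟩).2
  refine ⟨⟨F, hFD, E₀, hE₀, hFE₀, hne₀, hr₀, hFE₀⟩, fun F' hF'D => ⟨?_, ?_⟩⟩
  · rintro ⟨E, hE, hFE, hne, hr, hF'E⟩
    obtain ⟨G, hG, hFG, hGE⟩ := (hface (F ∪ F') (Finset.union_subset hFD hF'D)).1
      ⟨E, hE, hne, hr, Finset.union_subset hFE hF'E⟩
    exact ⟨G, hG, Finset.union_subset_left hFG, Finset.union_subset_right hFG, hGE⟩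
  · rintro ⟨G, -, hFG, hF'G, E, hE, hne, hr, hGE⟩
    exact ⟨E, hE, hFG.trans hGE, hne, hr, hF'G.trans hGE⟩
end

section
/- Let Δ be a finite thin pure d-dimensional shellable simplicial complex with shelling ≤_S and restriction map R. Consider the two relations on chambers: E ρ D iff R(E) ≤ D, and E ρʳ D iff R(E) ≤ D and E and D are adjacent (share a facet). Then the transitive closures of ρ and ρʳ are identical; i.e. the partial orders ≤_C and ≤_C^r defined from the shelling coincide. -/
open scoped Classical

theorem Cplx.IsFacetOf.exists_eq_erase_s15 {V : Type*} [DecidableEq V] {Δ : Cplx V} {G D : Finset V}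
    (h : Δ.IsFacetOf G D) : ∃ v ∈ D, v ∉ G ∧ G = D.erase v := by
  obtain ⟨hGD, hcard⟩ := h
  obtain ⟨v, hvD, hvG⟩ := Finset.exists_of_ssubset
    (Finset.ssubset_iff_subset_ne.2 ⟨hGD, fun h => by subst h; omega⟩)
  refine ⟨v, hvD, hvG, Finset.eq_of_subset_of_card_le (Finset.subset_erase.2 ⟨hGD, hvG⟩) ?_⟩
  rw [Finset.card_erase_of_mem hvD]
  omega

/-- The restriction of a chamber `E` lies in no chamber strictly earlier than `E`. -/
theorem IsShelling.not_earlierFace_resMap {V : Type*} [DecidableEq V] {Δ : Cplx V}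
    {r : Finset V → Finset V → Prop} (hshell : IsShelling Δ r) {E : Finset V}
    (hE : Δ.Chamber E) : ¬ EarlierFace Δ r E (resMap Δ r E) := by
  intro h
  have hfirst : ∃ F, Δ.Chamber F ∧ F ≠ E ∧ r F E := by
    obtain ⟨F, hF, hne, hr, -⟩ := h
    exact ⟨F, hF, hne, hr⟩
  obtain ⟨G, hG, hRG, hGe⟩ := ((hshell.2 E hE hfirst).2 _ (Finset.filter_subset _ _)).1 h
  obtain ⟨v, hvE, hvG, rfl⟩ := hG.exists_eq_erase_s15
  exact hvG (hRG (Finset.mem_filter.2 ⟨hvE, hGe⟩))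

/-- In a thin complex, if two chambers share a facet `G` then the restriction of the earlier one
is contained in `G`. -/
theorem Cplx.Thin.resMap_subset_facet {V : Type*} [DecidableEq V] {Δ : Cplx V}
    (hthin : Δ.Thin) {r : Finset V → Finset V → Prop} (hlin : LinOrderOn Δ r)
    {D D' G : Finset V} (hD : Δ.Chamber D) (hD' : Δ.Chamber D') (hne : D' ≠ D) (hr : r D' D)
    (hGD : G ⊆ D) (hG : Δ.IsFacetOf G D') : resMap Δ r D' ⊆ G := by
  intro w hw
  by_contra hwG
  obtain ⟨hwD', F, hF, hFne, hFr, hFs⟩ := Finset.mem_filter.1 hw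
  have hGF : G ⊆ F := (Finset.subset_erase.2 ⟨hG.1, hwG⟩).trans hFs
  obtain ⟨D₁, D₂, -, -, -, -, -, huniq⟩ := hthin G D' hD' hG
  have hFD : F = D := by
    rcases huniq F hF hGF with h | h <;> rcases huniq D hD hGD with h' | h' <;>
      rcases huniq D' hD' hG.1 with h'' | h'' <;> simp_all
  subst hFD
  exact hne (hlin.2.1 _ _ hD' hD hr hFr)

/-- The strict order on chambers induced by a linear order is well-founded. -/
theorem LinOrderOn.wellFounded_strict {V : Type*} [DecidableEq V] {Δ : Cplx V}
    {r : Finset V → Finset V → Prop} (hlin : LinOrderOn Δ r) :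
    WellFounded fun E D => Δ.Chamber E ∧ Δ.Chamber D ∧ E ≠ D ∧ r E D := by
  refine Subrelation.wf (r := InvImage (· < ·) fun D =>
    (Δ.faces.filter fun F => Δ.Chamber F ∧ r F D).card) ?_ (InvImage.wf _ wellFounded_lt)
  rintro E D ⟨hE, hD, hne, hr⟩
  refine Finset.card_lt_card (Finset.ssubset_iff_of_subset ?_ |>.2 ⟨D, ?_, ?_⟩)
  · intro F hF
    simp only [Finset.mem_filter] at hF ⊢
    exact ⟨hF.1, hF.2.1, hlin.2.2.1 _ _ _ hF.2.1 hE hD hF.2.2 hr⟩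
  · exact Finset.mem_filter.2 ⟨hD.1, hD, hlin.1 D hD⟩
  · intro h
    exact hne (hlin.2.1 _ _ hE hD hr (Finset.mem_filter.1 h).2.2)

/-- A chamber `D` containing the restriction of a chamber `E` is reached from `E` through adjacent
chambers, each containing the restriction of the previous one. -/
theorem IsShelling.reflTransGen_of_resMap_subset {V : Type*} [DecidableEq V] {Δ : Cplx V} {n : ℕ}
    (hpure : Δ.Pure n) (hthin : Δ.Thin) {r : Finset V → Finset V → Prop}
    (hshell : IsShelling Δ r) {E D : Finset V} (hE : Δ.Chamber E) (hD : Δ.Chamber D)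
    (hED : resMap Δ r E ⊆ D) :
    Relation.ReflTransGen
      (fun E' D' => Δ.Chamber E' ∧ Δ.Chamber D' ∧ resMap Δ r E' ⊆ D' ∧
        ∃ G, G ⊆ E' ∧ G ⊆ D' ∧ G.card + 1 = E'.card) E D := by
  induction D using hshell.1.wellFounded_strict.induction with
  | _ D ih =>
  rcases eq_or_ne E D with rfl | hne
  · exact .refl
  have hr : r E D := (hshell.1.2.2.2 E D hE hD).resolve_right fun h =>
    hshell.not_earlierFace_resMap hE ⟨D, hD, hne.symm, h, hED⟩
  obtain ⟨G, hG, hIG, D', hD', hne', hr', hGD'⟩ :=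
    ((hshell.2 D hD ⟨E, hE, hne, hr⟩).2 (E ∩ D) Finset.inter_subset_right).1
      ⟨E, hE, hne, hr, Finset.inter_subset_left⟩
  have hRG : resMap Δ r E ⊆ G :=
    (Finset.subset_inter (Finset.filter_subset _ _) hED).trans hIG
  have hG' : Δ.IsFacetOf G D' := ⟨hGD', by rw [hG.2, hpure D hD, hpure D' hD']⟩
  exact (ih D' ⟨hD', hD, hne', hr'⟩ hD' (hRG.trans hGD')).tail ⟨hD', hD,
    (hthin.resMap_subset_facet hshell.1 hD hD' hne' hr' hG.1 hG').trans hG.1, G, hGD', hG.1, hG'.2⟩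

/-- For a thin shellable complex with shelling `r` and restriction map `R`, the
transitive closure of the relation `E ⪯ D` iff `R(E) ≤ D` coincides with the
transitive closure of the refined relation `E ⪯ʳ D` iff `R(E) ≤ D` and `E`, `D`
are adjacent (share a facet); i.e. the partial orders `≤_C` and `≤_C^r` agree. -/
theorem stmt_15 {V : Type*} [DecidableEq V] (Δ : Cplx V) (d : ℕ)
    (hpure : Δ.Pure (d + 1)) (hthin : Cplx.Thin Δ)
    (r : Finset V → Finset V → Prop) (hshell : IsShelling Δ r) :
    ∀ E D : Finset V,
      Relation.ReflTransGen
        (fun E' D' => Δ.Chamber E' ∧ Δ.Chamber D' ∧ resMap Δ r E' ⊆ D') E D ↔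
      Relation.ReflTransGen
        (fun E' D' => Δ.Chamber E' ∧ Δ.Chamber D' ∧ resMap Δ r E' ⊆ D' ∧
          ∃ G, G ⊆ E' ∧ G ⊆ D' ∧ G.card + 1 = E'.card) E D := by
  intro E D
  constructor
  · intro h
    induction h with
    | refl => exact .refl
    | tail _ h ih =>
      exact ih.trans (hshell.reflTransGen_of_resMap_subset hpure hthin h.1 h.2.1 h.2.2)
  · exact fun h => Relation.ReflTransGen.mono (fun _ _ h => ⟨h.1, h.2.1, h.2.2.1⟩) _ _ h
end

section
/- Let F be a partially ordered set equipped with an associative product F × F → F, let C ⊆ F be the set of maximal elements of F, and assume C is a left ideal (FC ∈ C for all F ∈ F and C ∈ C). Assume: (i) F ≤ FC for all F ∈ F, C ∈ C; (ii) if F ≤ C then FC = C; (iii) if FC = D and F ≤ G ≤ D then GC = D; and additionally F ≤ FF′ for all F, F′ ∈ F. Then axiom (P3) holds: if FC = D and C_1 − C_2 − ⋯ − C_n = D is a weak C-gallery (i.e. for each 1 ≤ i ≤ n−1 there is F_i ∈ F with F_i ≤ C_i, F_i ≤ C_{i+1} and F_i C = C_i), then FC_1 = D. -/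
/-- An element of a poset is maximal (a chamber). -/
def MaxElt {F : Type*} [PartialOrder F] (c : F) : Prop :=
  ∀ y, c ≤ y → y = c

/-- `D` and `E` are weakly `C`-adjacent: they are chambers with a common lower
bound `f` such that `f * C = D`. -/
def WAdj {F : Type*} [PartialOrder F] [Mul F] (C D E : F) : Prop :=
  MaxElt D ∧ MaxElt E ∧ ∃ f : F, f ≤ D ∧ f ≤ E ∧ f * C = D

/-- Let `F` be a poset with an associative product whose set `C` of maximal
elements (chambers) is a left ideal, satisfying axiom (P1) together with
`f ≤ f * f'`. Then axiom (P3) holds: if `f * C = D` and `C₁ − C₂ − ⋯ − Cₙ = D`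
is a weak `C`-gallery, then `f * C₁ = D`. -/
theorem stmt_16 {F : Type*} [PartialOrder F] [Mul F]
    (hassoc : ∀ a b c : F, a * b * c = a * (b * c))
    (hideal : ∀ (f c : F), MaxElt c → MaxElt (f * c))
    (h1i : ∀ f c : F, MaxElt c → f ≤ f * c)
    (h1ii : ∀ f c : F, MaxElt c → f ≤ c → f * c = c)
    (h1iii : ∀ f g c : F, MaxElt c → f ≤ g → g ≤ f * c → g * c = f * c)
    (hextra : ∀ f f' : F, f ≤ f * f')
    (C C₁ D f : F) (hC : MaxElt C) (hC₁ : MaxElt C₁)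
    (hD : f * C = D)
    (hgal : Relation.ReflTransGen (WAdj C) C₁ D) :
    f * C₁ = D := by
  induction hgal using Relation.ReflTransGen.head_induction_on with
  | refl => exact h1ii f D hC₁ (hD ▸ h1i f C hC)
  | @head A B hadj _ ih =>
    obtain ⟨_, hB, g, -, hgB, hgC⟩ := hadj
    have hfB : f * B = D := ih hB
    have hle : f * g ≤ f * C := by
      have h := h1i (f * g) B hB
      rwa [hassoc, h1ii g B hB hgB, hfB, ← hD] at h
    rw [← hgC, ← hassoc, h1iii f (f * g) C hC (hextra f g) hle, hD]
end

section
/- Let q be a prime power, V = 𝔽_q^n with standard basis e_1, …, e_n, let C be the standard complete flag V_i = span(e_1,…,e_i), let C̄ be the opposite flag V̄_i = span(e_n, e_{n−1}, …, e_{n−i+1}), and for a permutation σ of {1,…,n} let D be the complete flag W_i = span(e_{σ(1)},…,e_{σ(i)}). Then: (1) the number of frames of V adapted to both C and D equals q^{a(σ)}, where a(σ) = #{(j,k) : 1 ≤ j < k ≤ n, σ(j) < σ(k)}; (2) the number of frames adapted to both D and C̄ equals q^{b(σ)}, where b(σ) = #{(j,k) : 1 ≤ j < k ≤ n, σ(j)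 > σ(k)}; consequently (3) the product of these two numbers equals q^{n(n−1)/2}, the number of frames adapted to D. (This verifies, for the building of type A_{n−1}, the identity |A_{C,D}| · |A_{D,C̄}| = |A_D| for a pair of opposite chambers C, C̄ and any chamber D in the apartment they determine.) -/
/-- A frame of an `n`-dimensional vector space `V`: a set of `n` one-dimensional
subspaces `L₁, …, Lₙ` with `V = L₁ ⊕ ⋯ ⊕ Lₙ`. -/
def IsFrame (𝔽 : Type*) [Field 𝔽] (V : Type*) [AddCommGroup V] [Module 𝔽 V]
    (n : ℕ) (L : Finset (Submodule 𝔽 V)) : Prop :=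
  L.card = n ∧ (∀ W ∈ L, Module.finrank 𝔽 W = 1) ∧
  sSupIndep (↑L : Set (Submodule 𝔽 V)) ∧
  sSup (↑L : Set (Submodule 𝔽 V)) = ⊤

/-- A frame is adapted to a complete flag if each term `V_i` of the flag is the sum
of some `i` of the lines of the frame. -/
def Adapted (𝔽 : Type*) [Field 𝔽] (V : Type*) [AddCommGroup V] [Module 𝔽 V]
    (n : ℕ) (L : Finset (Submodule 𝔽 V)) (flag : ℕ → Submodule 𝔽 V) : Prop :=
  ∀ i ≤ n, ∃ T ⊆ L, T.card = i ∧ flag i = sSup (↑T : Set (Submodule 𝔽 V))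

/-- The complete flag in `𝔽^n` whose `i`-th term is spanned by
`e_{ρ(0)}, …, e_{ρ(i-1)}`, for a permutation `ρ` of the index set. -/
noncomputable def flagOf (𝔽 : Type*) [Field 𝔽] (n : ℕ) (ρ : Equiv.Perm (Fin n))
    (i : ℕ) : Submodule 𝔽 (Fin n → 𝔽) :=
  Submodule.span 𝔽 ((fun j => Pi.basisFun 𝔽 (Fin n) (ρ j)) '' {j : Fin n | (j : ℕ) < i})

open Finset in
theorem Function.Injective.eq_self_of_forall_le {α : Type*} [Fintype α] (f : α → ℕ)
    (hf : Function.Injective f) (π : α → α) (hπ : Function.Injective π)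
    (h : ∀ a, f a ≤ f (π a)) (a : α) : π a = a := by
  have hb : Function.Bijective π := Finite.injective_iff_bijective.1 hπ
  have hs : ∑ a, f a = ∑ a, f (π a) := (hb.sum_comp f).symm
  exact (hf ((sum_eq_sum_iff_of_le fun i _ => h i).1 hs a (mem_univ a))).symm

theorem mem_flagOf_iff {𝔽 : Type*} [Field 𝔽] {n : ℕ} {ρ : Equiv.Perm (Fin n)} {i : ℕ}
    {v : Fin n → 𝔽} :
    v ∈ flagOf 𝔽 n ρ i ↔ ∀ a, v a ≠ 0 → (ρ.symm a : ℕ) < i := by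
  have h : (fun j => Pi.basisFun 𝔽 (Fin n) (ρ j)) '' {j : Fin n | (j : ℕ) < i} =
      Pi.basisFun 𝔽 (Fin n) '' {a : Fin n | (ρ.symm a : ℕ) < i} := by
    ext x
    constructor
    · rintro ⟨j, hj, rfl⟩
      exact ⟨ρ j, by simpa using hj, rfl⟩
    · rintro ⟨a, ha, rfl⟩
      exact ⟨ρ.symm a, ha, by simp⟩
  rw [flagOf, h, Module.Basis.mem_span_image]
  simp [Set.subset_def]

/-- The rows of `M` are obtained from the standard basis by adding to each `e_b` a combination
of vectors `e_a` with `a` before `b` in the order defined by `ρ`. -/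
def IsUnitriangular {𝔽 : Type*} [Field 𝔽] {n : ℕ} (ρ : Equiv.Perm (Fin n))
    (M : Fin n → Fin n → 𝔽) : Prop :=
  ∀ b, M b b = 1 ∧ ∀ a, M b a ≠ 0 → ρ.symm a ≤ ρ.symm b

/-- The set of lines spanned by the rows of `M`. -/
noncomputable def rowLines {𝔽 : Type*} [Field 𝔽] {n : ℕ} (M : Fin n → Fin n → 𝔽) :
    Finset (Submodule 𝔽 (Fin n → 𝔽)) :=
  open Classical in Finset.univ.image fun b => Submodule.span 𝔽 {M b}

namespace IsUnitriangular

variable {𝔽 : Type*} [Field 𝔽] {n : ℕ} {ρ τ : Equiv.Perm (Fin n)} {M N : Fin n → Fin n → 𝔽}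

theorem flagOf_eq_span (hM : IsUnitriangular ρ M) (i : ℕ) :
    flagOf 𝔽 n ρ i = Submodule.span 𝔽 (M '' {b | (ρ.symm b : ℕ) < i}) := by
  apply le_antisymm
  · have key : ∀ k : ℕ, k ≤ i → flagOf 𝔽 n ρ k ≤
        Submodule.span 𝔽 (M '' {b | (ρ.symm b : ℕ) < i}) := by
      intro k
      induction k with
      | zero =>
        intro _ v hv
        have : v = 0 := by
          ext a
          by_contra h
          exact absurd (mem_flagOf_iff.1 hv a h) (Nat.not_lt_zero _)
        simp [this]
      | succ k ih =>
        intro hk v hv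
        rw [mem_flagOf_iff] at hv
        by_cases hkn : k < n
        · set b : Fin n := ρ ⟨k, hkn⟩ with hb
          have hbk : (ρ.symm b : ℕ) = k := by simp [hb]
          have h1 : v - v b • M b ∈ flagOf 𝔽 n ρ k := by
            rw [mem_flagOf_iff]
            intro a ha
            have hle : (ρ.symm a : ℕ) ≤ k := by
              by_contra hlt
              have h2 : v a = 0 := by
                by_contra h; have := hv a h; omega
              have h3 : M b a = 0 := by
                by_contra h
                have := (hM b).2 a h
                rw [Fin.le_def] at this
                omega
              simp [h2, h3] at ha
            refine lt_of_le_of_ne hle fun h => ha ?_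
            have hab : a = b := ρ.symm.injective (Fin.ext (h.trans hbk.symm))
            simp [hab, (hM b).1]
          have h2 : M b ∈ Submodule.span 𝔽 (M '' {b | (ρ.symm b : ℕ) < i}) :=
            Submodule.subset_span ⟨b, by simp only [Set.mem_ofPred_eq]; omega, rfl⟩
          have h3 := Submodule.add_mem _ (ih (by omega) h1) (Submodule.smul_mem _ (v b) h2)
          simpa using h3
        · refine ih (by omega) (mem_flagOf_iff.2 fun a _ => ?_)
          have := (ρ.symm a).2
          omega
    exact key i le_rfl
  · rw [Submodule.span_le]
    rintro _ ⟨b, hb, rfl⟩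
    refine mem_flagOf_iff.2 fun a ha => ?_
    have := (hM b).2 a ha
    rw [Fin.le_def] at this
    exact lt_of_le_of_lt this hb

theorem span_range_eq_top (hM : IsUnitriangular ρ M) :
    Submodule.span 𝔽 (Set.range M) = ⊤ := by
  have h := hM.flagOf_eq_span n
  simp only [Fin.is_lt, Set.ofPred_true, Set.image_univ] at h
  rw [← h, eq_top_iff]
  exact fun v _ => mem_flagOf_iff.2 fun a _ => (ρ.symm a).2

theorem linearIndependent (hM : IsUnitriangular ρ M) : LinearIndependent 𝔽 M :=
  linearIndependent_of_top_le_span_of_card_eq_finrank hM.span_range_eq_top.ge (by simp)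

theorem span_singleton_injective (hM : IsUnitriangular ρ M) :
    Function.Injective fun b => Submodule.span 𝔽 {M b} :=
  hM.linearIndependent.iSupIndep_span_singleton.injective fun b => by
    simpa using hM.linearIndependent.ne_zero b

theorem isFrame_rowLines (hM : IsUnitriangular ρ M) :
    IsFrame 𝔽 (Fin n → 𝔽) n (rowLines M) := by
  classical
  have hc : (rowLines M : Set (Submodule 𝔽 (Fin n → 𝔽))) =
      Set.range fun b => Submodule.span 𝔽 {M b} := by
    simp [rowLines]
  refine ⟨?_, ?_, ?_, ?_⟩
  · rw [rowLines, Finset.card_image_of_injective _ hM.span_singleton_injective]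
    simp
  · intro W hW
    obtain ⟨b, -, rfl⟩ := Finset.mem_image.1 hW
    exact finrank_span_singleton (hM.linearIndependent.ne_zero b)
  · rw [hc]
    exact hM.linearIndependent.iSupIndep_span_singleton.sSupIndep_range
  · rw [hc, sSup_range, ← Submodule.span_range_eq_iSup, hM.span_range_eq_top]

theorem adapted_rowLines (hM : IsUnitriangular ρ M) :
    Adapted 𝔽 (Fin n → 𝔽) n (rowLines M) (flagOf 𝔽 n ρ) := by
  classical
  intro i hi
  refine ⟨(Finset.univ.filter fun b : Fin n => (ρ.symm b : ℕ) < i).image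
    fun b => Submodule.span 𝔽 {M b}, Finset.image_subset_image (Finset.filter_subset _ _), ?_, ?_⟩
  · rw [Finset.card_image_of_injective _ hM.span_singleton_injective,
      ← Finset.card_map ρ.symm.toEmbedding]
    have : (Finset.univ.filter fun b : Fin n => (ρ.symm b : ℕ) < i).map ρ.symm.toEmbedding =
        Finset.univ.filter fun b : Fin n => (b : ℕ) < i := by
      ext x
      simp
    rw [this, Fin.card_filter_val_lt, min_eq_right hi]
  · rw [hM.flagOf_eq_span, Finset.coe_image, sSup_image, Submodule.span_eq_iSup_of_singleton_spans,
      iSup_image]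
    simp

theorem rowLines_injective (hM : IsUnitriangular ρ M) (hN : IsUnitriangular ρ N)
    (h : rowLines M = rowLines N) : M = N := by
  classical
  funext b
  have hb : Submodule.span 𝔽 {M b} ∈ rowLines N := by
    rw [← h]
    exact Finset.mem_image_of_mem _ (Finset.mem_univ b)
  obtain ⟨b', -, hb'⟩ := Finset.mem_image.1 hb
  have hm : M b ∈ Submodule.span 𝔽 {N b'} := hb' ▸ Submodule.mem_span_singleton_self _
  obtain ⟨c, hc⟩ := Submodule.mem_span_singleton.1 hm
  have hca : ∀ a, c * N b' a = M b a := fun a => by simpa using congrFun hc a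
  have hcb : c * N b' b = 1 := by rw [hca, (hM b).1]
  have hc0 : c ≠ 0 := left_ne_zero_of_mul_eq_one hcb
  have h1 := (hN b').2 b (right_ne_zero_of_mul_eq_one hcb)
  have h2 := (hM b).2 b' (by rw [← hca, (hN b').1, mul_one]; exact hc0)
  obtain rfl : b = b' := ρ.symm.injective (le_antisymm h1 h2)
  rw [(hN b).1, mul_one] at hcb
  rw [← hc, hcb, one_smul]

end IsUnitriangular

/-- Each index `b` leads some line of a frame adapted to `flagOf 𝔽 n ρ`: the coordinate `b` is
nonzero on the line and comes last in the order defined by `ρ`. -/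
theorem Adapted.exists_leading {𝔽 : Type*} [Field 𝔽] {n : ℕ} {ρ : Equiv.Perm (Fin n)}
    {L : Finset (Submodule 𝔽 (Fin n → 𝔽))}
    (h : Adapted 𝔽 (Fin n → 𝔽) n L (flagOf 𝔽 n ρ)) (b : Fin n) :
    ∃ W ∈ L, (∃ v ∈ W, v b ≠ 0) ∧ ∀ v ∈ W, ∀ a, v a ≠ 0 → ρ.symm a ≤ ρ.symm b := by
  classical
  obtain ⟨T, hTL, -, hT⟩ := h (ρ.symm b + 1) (ρ.symm b).2
  have hle : ∀ W ∈ T, W ≤ flagOf 𝔽 n ρ (ρ.symm b + 1) := fun W hW => hT ▸ le_sSup hW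
  have hlast : ∀ W ∈ T, ∀ v ∈ W, ∀ a, v a ≠ 0 → ρ.symm a ≤ ρ.symm b := fun W hW v hv a ha =>
    Nat.lt_succ_iff.1 (mem_flagOf_iff.1 (hle W hW hv) a ha)
  suffices hex : ∃ W ∈ T, ∃ v ∈ W, v b ≠ 0 by
    obtain ⟨W, hW, hv⟩ := hex
    exact ⟨W, hTL hW, hv, hlast W hW⟩
  by_contra! hno
  have hsub : flagOf 𝔽 n ρ (ρ.symm b + 1) ≤ LinearMap.ker (LinearMap.proj (R := 𝔽) b) := by
    rw [hT]
    exact sSup_le fun W hW v hv => by simpa using hno W hW v hv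
  have hmem : (Pi.single b 1 : Fin n → 𝔽) ∈ flagOf 𝔽 n ρ (ρ.symm b + 1) := by
    refine mem_flagOf_iff.2 fun a ha => ?_
    obtain rfl : a = b := by
      by_contra hab
      exact ha (Pi.single_eq_of_ne hab _)
    exact Nat.lt_succ_self _
  simpa using hsub hmem

theorem IsFrame.exists_isUnitriangular {𝔽 : Type*} [Field 𝔽] {n : ℕ} {ρ τ : Equiv.Perm (Fin n)}
    {L : Finset (Submodule 𝔽 (Fin n → 𝔽))} (hL : IsFrame 𝔽 (Fin n → 𝔽) n L)
    (hρ : Adapted 𝔽 (Fin n → 𝔽) n L (flagOf 𝔽 n ρ))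
    (hτ : Adapted 𝔽 (Fin n → 𝔽) n L (flagOf 𝔽 n τ)) :
    ∃ M, IsUnitriangular ρ M ∧ IsUnitriangular τ M ∧ rowLines M = L := by
  classical
  choose f hfL hf1 hf2 using hρ.exists_leading
  choose g hgL hg1 hg2 using hτ.exists_leading
  have hfi : Function.Injective f := fun b b' h => by
    obtain ⟨v, hv, hvb⟩ := hf1 b
    obtain ⟨w, hw, hwb⟩ := hf1 b'
    exact ρ.symm.injective (le_antisymm (hf2 b' v (h ▸ hv) b hvb) (hf2 b w (h ▸ hw) b' hwb))
  have hgi : Function.Injective g := fun b b' h => by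
    obtain ⟨v, hv, hvb⟩ := hg1 b
    obtain ⟨w, hw, hwb⟩ := hg1 b'
    exact τ.symm.injective (le_antisymm (hg2 b' v (h ▸ hv) b hvb) (hg2 b w (h ▸ hw) b' hwb))
  have hfL' : Finset.univ.image f = L :=
    Finset.eq_of_subset_of_card_le (Finset.image_subset_iff.2 fun b _ => hfL b)
      (by rw [Finset.card_image_of_injective _ hfi, hL.1]; simp)
  have hgL' : Finset.univ.image g = L :=
    Finset.eq_of_subset_of_card_le (Finset.image_subset_iff.2 fun b _ => hgL b)
      (by rw [Finset.card_image_of_injective _ hgi, hL.1]; simp)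
  have hex : ∀ b, ∃ b', g b' = f b := fun b => by
    have : f b ∈ Finset.univ.image g := hgL' ▸ hfL b
    simpa using this
  choose π hπ using hex
  have hid : ∀ b, π b = b := by
    refine Function.Injective.eq_self_of_forall_le (fun b => (τ.symm b : ℕ))
      (fun a b h => τ.symm.injective (Fin.ext h)) π
      (fun a b h => hfi (by rw [← hπ, ← hπ, h])) fun b => ?_
    obtain ⟨v, hv, hvb⟩ := hf1 b
    exact hg2 (π b) v (hπ b ▸ hv) b hvb
  have hfg : ∀ b, g b = f b := fun b => by rw [← hπ b, hid b]
  have hM : ∀ b, ∃ v ∈ f b, v b = 1 := fun b => by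
    obtain ⟨v, hv, hvb⟩ := hf1 b
    exact ⟨(v b)⁻¹ • v, Submodule.smul_mem _ _ hv, by simp [hvb]⟩
  choose M hMf hM1 using hM
  refine ⟨M, fun b => ⟨hM1 b, hf2 b _ (hMf b)⟩,
    fun b => ⟨hM1 b, hg2 b _ (hfg b ▸ hMf b)⟩, ?_⟩
  rw [← hfL', rowLines]
  refine Finset.image_congr fun b _ => ?_
  have hle : Submodule.span 𝔽 {M b} ≤ f b := by simpa using hMf b
  have hfin : Module.finrank 𝔽 (f b) = 1 := hL.2.1 _ (hfL b)
  refine Submodule.eq_of_le_of_finrank_eq hle ?_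
  rw [hfin]
  refine finrank_span_singleton fun h => ?_
  have := hM1 b
  simp [h] at this

/-- The matrix with ones on the diagonal and prescribed entries at the pairs related by `R`. -/
def unitriangularOf {𝔽 : Type*} [Field 𝔽] {n : ℕ} (R : Fin n × Fin n → Prop) [DecidablePred R]
    (c : {p // R p} → 𝔽) (b a : Fin n) : 𝔽 :=
  if a = b then 1 else if h : R (a, b) then c ⟨(a, b), h⟩ else 0

theorem ncard_frames_adapted {𝔽 : Type*} [Field 𝔽] [Fintype 𝔽] {n : ℕ}
    (ρ τ : Equiv.Perm (Fin n)) :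
    {L : Finset (Submodule 𝔽 (Fin n → 𝔽)) | IsFrame 𝔽 (Fin n → 𝔽) n L ∧
        Adapted 𝔽 (Fin n → 𝔽) n L (flagOf 𝔽 n ρ) ∧
        Adapted 𝔽 (Fin n → 𝔽) n L (flagOf 𝔽 n τ)}.ncard =
      Fintype.card 𝔽 ^ (Finset.univ.filter fun p : Fin n × Fin n =>
        ρ.symm p.1 < ρ.symm p.2 ∧ τ.symm p.1 < τ.symm p.2).card := by
  classical
  let R : Fin n × Fin n → Prop := fun p => ρ.symm p.1 < ρ.symm p.2 ∧ τ.symm p.1 < τ.symm p.2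
  have hR : ∀ c : {p // R p} → 𝔽, IsUnitriangular ρ (unitriangularOf R c) ∧
      IsUnitriangular τ (unitriangularOf R c) := by
    refine fun c => ⟨fun b => ⟨by simp [unitriangularOf], fun a ha => ?_⟩,
      fun b => ⟨by simp [unitriangularOf], fun a ha => ?_⟩⟩ <;>
    · by_cases hab : a = b
      · rw [hab]
      · by_cases h : R (a, b)
        · first | exact h.1.le | exact h.2.le
        · simp [unitriangularOf, hab, h] at ha
  have hinj : Function.Injective fun c : {p // R p} → 𝔽 => rowLines (unitriangularOf R c) := by
    intro c d h
    have hcd := (hR c).1.rowLines_injective (hR d).1 h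
    funext ⟨⟨a, b⟩, hp⟩
    have hne : a ≠ b := fun hab => by
      subst hab
      exact lt_irrefl _ hp.1
    simpa [unitriangularOf, hne, hp] using congrFun (congrFun hcd b) a
  have hset : {L : Finset (Submodule 𝔽 (Fin n → 𝔽)) | IsFrame 𝔽 (Fin n → 𝔽) n L ∧
        Adapted 𝔽 (Fin n → 𝔽) n L (flagOf 𝔽 n ρ) ∧
        Adapted 𝔽 (Fin n → 𝔽) n L (flagOf 𝔽 n τ)} =
      Set.range fun c : {p // R p} → 𝔽 => rowLines (unitriangularOf R c) := by
    ext L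
    constructor
    · rintro ⟨hL, h1, h2⟩
      obtain ⟨M, hM1, hM2, rfl⟩ := hL.exists_isUnitriangular h1 h2
      refine ⟨fun p => M p.1.2 p.1.1, congrArg rowLines ?_⟩
      funext b a
      by_cases hab : a = b
      · simp [unitriangularOf, hab, (hM1 b).1]
      · by_cases hp : R (a, b)
        · simp [unitriangularOf, hab, hp]
        · simp only [unitriangularOf, hab, hp, if_false, dif_neg, not_false_iff]
          by_contra h
          exact hp ⟨((hM1 b).2 a (Ne.symm h)).lt_of_ne (ρ.symm.injective.ne hab),
            ((hM2 b).2 a (Ne.symm h)).lt_of_ne (τ.symm.injective.ne hab)⟩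
    · rintro ⟨c, rfl⟩
      exact ⟨(hR c).1.isFrame_rowLines, (hR c).1.adapted_rowLines, (hR c).2.adapted_rowLines⟩
  rw [hset, ← Set.image_univ, Set.ncard_image_of_injective _ hinj, Set.ncard_univ,
    Nat.card_eq_fintype_card, Fintype.card_fun, Fintype.card_subtype]

theorem card_filter_symm {n : ℕ} (σ : Equiv.Perm (Fin n)) (P : Fin n × Fin n → Prop)
    [DecidablePred P] :
    (Finset.univ.filter fun p : Fin n × Fin n => P (σ.symm p.1, σ.symm p.2)).card =
      (Finset.univ.filter P).card := by
  refine Finset.card_equiv (σ.symm.prodCongr σ.symm) fun p => ?_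
  simp only [Finset.mem_filter, Finset.mem_univ, true_and]
  rfl

theorem card_filter_fst_lt_snd (n : ℕ) :
    (Finset.univ.filter fun p : Fin n × Fin n => p.1 < p.2).card = n * (n - 1) / 2 := by
  rw [← Finset.sum_range_id, ← Fin.sum_univ_eq_sum_range (fun i => i), Finset.card_filter,
    Fintype.sum_prod_type_right]
  refine Finset.sum_congr rfl fun k _ => ?_
  rw [← Finset.card_filter, Finset.filter_gt_eq_Iio, Fin.card_Iio]

/-- For the building of type `A_{n−1}` over `𝔽_q`: let `C` be the standard complete
flag of `V = 𝔽_q^n` (spanned by `e₁, …, e_i`), `C̄` the opposite flag (spanned by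
`e_n, …, e_{n−i+1}`), and `D` the flag spanned by `e_{σ(1)}, …, e_{σ(i)}` for a
permutation `σ`. Then the number of frames adapted to both `C` and `D` is
`q^{a(σ)}` with `a(σ) = #{(j,k) : j < k, σ(j) < σ(k)}`, the number adapted to both
`D` and `C̄` is `q^{b(σ)}` with `b(σ) = #{(j,k) : j < k, σ(j) > σ(k)}`, and the
product of the two numbers is `q^{n(n−1)/2}`, the number of frames adapted to `D`
(i.e. `|A_{C,D}| ⬝ |A_{D,C̄}| = |A_D|`). -/
theorem stmt_18 (𝔽 : Type*) [Field 𝔽] [Fintype 𝔽] (n : ℕ)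
    (σ : Equiv.Perm (Fin n)) :
    {L : Finset (Submodule 𝔽 (Fin n → 𝔽)) |
        IsFrame 𝔽 (Fin n → 𝔽) n L ∧
        Adapted 𝔽 (Fin n → 𝔽) n L (flagOf 𝔽 n (Equiv.refl (Fin n))) ∧
        Adapted 𝔽 (Fin n → 𝔽) n L (flagOf 𝔽 n σ)}.ncard =
      Fintype.card 𝔽 ^
        ((Finset.univ.filter fun p : Fin n × Fin n =>
          p.1 < p.2 ∧ σ p.1 < σ p.2).card) ∧
    {L : Finset (Submodule 𝔽 (Fin n → 𝔽)) |
        IsFrame 𝔽 (Fin n → 𝔽) n L ∧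
        Adapted 𝔽 (Fin n → 𝔽) n L (flagOf 𝔽 n σ) ∧
        Adapted 𝔽 (Fin n → 𝔽) n L (flagOf 𝔽 n Fin.revPerm)}.ncard =
      Fintype.card 𝔽 ^
        ((Finset.univ.filter fun p : Fin n × Fin n =>
          p.1 < p.2 ∧ σ p.2 < σ p.1).card) ∧
    {L : Finset (Submodule 𝔽 (Fin n → 𝔽)) |
        IsFrame 𝔽 (Fin n → 𝔽) n L ∧
        Adapted 𝔽 (Fin n → 𝔽) n L (flagOf 𝔽 n (Equiv.refl (Fin n))) ∧
        Adapted 𝔽 (Fin n → 𝔽) n L (flagOf 𝔽 n σ)}.ncard *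
    {L : Finset (Submodule 𝔽 (Fin n → 𝔽)) |
        IsFrame 𝔽 (Fin n → 𝔽) n L ∧
        Adapted 𝔽 (Fin n → 𝔽) n L (flagOf 𝔽 n σ) ∧
        Adapted 𝔽 (Fin n → 𝔽) n L (flagOf 𝔽 n Fin.revPerm)}.ncard =
      {L : Finset (Submodule 𝔽 (Fin n → 𝔽)) |
        IsFrame 𝔽 (Fin n → 𝔽) n L ∧
        Adapted 𝔽 (Fin n → 𝔽) n L (flagOf 𝔽 n σ)}.ncard ∧
    {L : Finset (Submodule 𝔽 (Fin n → 𝔽)) |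
        IsFrame 𝔽 (Fin n → 𝔽) n L ∧
        Adapted 𝔽 (Fin n → 𝔽) n L (flagOf 𝔽 n σ)}.ncard =
      Fintype.card 𝔽 ^ (n * (n - 1) / 2) := by
  have h1 := ncard_frames_adapted (𝔽 := 𝔽) (Equiv.refl (Fin n)) σ
  have h2 := ncard_frames_adapted (𝔽 := 𝔽) σ Fin.revPerm
  have h3 := ncard_frames_adapted (𝔽 := 𝔽) σ σ
  have e1 : (Finset.univ.filter fun p : Fin n × Fin n =>
      (Equiv.refl (Fin n)).symm p.1 < (Equiv.refl (Fin n)).symm p.2 ∧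
        σ.symm p.1 < σ.symm p.2).card =
      (Finset.univ.filter fun p : Fin n × Fin n => p.1 < p.2 ∧ σ p.1 < σ p.2).card := by
    rw [← card_filter_symm σ fun p => p.1 < p.2 ∧ σ p.1 < σ p.2]
    exact congrArg _ (Finset.filter_congr fun p _ => by simp [and_comm])
  have e2 := card_filter_symm σ fun p => p.1 < p.2 ∧ σ p.2 < σ p.1
  have e3 := card_filter_symm σ fun p => p.1 < p.2
  simp only [Equiv.apply_symm_apply] at e2
  rw [e1] at h1
  simp only [Fin.revPerm_symm, Fin.revPerm_apply, Fin.rev_lt_rev, e2] at h2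
  simp only [and_self, e3, card_filter_fst_lt_snd] at h3
  refine ⟨h1, h2, ?_, h3⟩
  rw [h1, h2, h3, ← pow_add, ← card_filter_fst_lt_snd,
    ← Finset.card_filter_add_card_filter_not (s := Finset.univ.filter fun p : Fin n × Fin n =>
      p.1 < p.2) fun p => σ p.1 < σ p.2, Finset.filter_filter, Finset.filter_filter]
  congr 3
  refine Finset.filter_congr fun p _ => and_congr_right fun hp => ?_
  rw [not_lt, le_iff_lt_or_eq, or_iff_left (σ.injective.ne hp.ne')]
end
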